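/- arXiv:1511.04645 — 2 statements merged into one kernel-verified Lean document; each statement's English description precedes it below -/
import Mathlib

section
/- If Γ is a finite simplicial graph and every vertex group G_v is weakly amenable with Cowling–Haagerup constant 1, then the graph product G(Γ) is weakly amenable with Cowling–Haagerup constant 1. -/
open scoped ComplexOrder
open scoped commutatorElement

/-! ## Operator-norm notions -/

/-- `φ` is completely bounded (as a Herz–Schur multiplier) with cb-norm at most `C`:
there are a Hilbert space `H` and bounded maps `α β : G → H` with
`φ (h⁻¹ * g) = ⟪α g, β h⟫` and `(sup ‖α‖) * (sup ‖β‖) ≤ C`. -/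
def HasCBNormBound {G : Type} [Group G] (φ : G → ℂ) (C : ℝ) : Prop :=
  ∃ (H : Type) (_ : NormedAddCommGroup H) (_ : InnerProductSpace ℂ H)
    (α β : G → H) (Ca Cb : ℝ),
      (∀ g, ‖α g‖ ≤ Ca) ∧ (∀ h, ‖β h‖ ≤ Cb) ∧ Ca * Cb ≤ C ∧
      ∀ g h : G, φ (h⁻¹ * g) = (inner ℂ (α g) (β h) : ℂ)

/-- A kernel `φ : G × G → ℂ` is completely bounded with cb-norm at most `C`. -/
def HasCBKernelBound {G : Type} (φ : G → G → ℂ) (C : ℝ) : Prop :=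
  ∃ (H : Type) (_ : NormedAddCommGroup H) (_ : InnerProductSpace ℂ H)
    (α β : G → H) (Ca Cb : ℝ),
      (∀ g, ‖α g‖ ≤ Ca) ∧ (∀ h, ‖β h‖ ≤ Cb) ∧ Ca * Cb ≤ C ∧
      ∀ g h : G, φ g h = (inner ℂ (α g) (β h) : ℂ)

/-- A function `φ : G → ℂ` is positive definite. -/
def IsPosDefFn {G : Type} [Group G] (φ : G → ℂ) : Prop :=
  ∀ (n : ℕ) (c : Fin n → ℂ) (x : Fin n → G),
    0 ≤ ∑ i, ∑ j, c i * (starRingEnd ℂ) (c j) * φ ((x j)⁻¹ * x i)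

/-- A kernel `Ψ : G × G → ℂ` is positive definite. -/
def IsPosDefKernel {X : Type} (Ψ : X → X → ℂ) : Prop :=
  ∀ (n : ℕ) (c : Fin n → ℂ) (x : Fin n → X),
    0 ≤ ∑ i, ∑ j, c i * (starRingEnd ℂ) (c j) * Ψ (x i) (x j)

/-- A (discrete) group is amenable iff it admits an approximate identity of finitely
supported positive definite functions; we use this characterization. -/
def AmenablePD (G : Type) [Group G] : Prop :=
  ∀ (S : Finset G) (ε : ℝ), 0 < ε →
    ∃ φ : G → ℂ, (Function.support φ).Finite ∧ IsPosDefFn φ ∧ ∀ g ∈ S, ‖φ g - 1‖ < ε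

/-- A group is weakly amenable with Cowling–Haagerup constant 1: there is a net of finitely
supported completely bounded functions converging to 1 pointwise with cb-norms with
limsup at most 1. -/
def WeaklyAmenableCH1 (G : Type) [Group G] : Prop :=
  ∀ (S : Finset G) (ε : ℝ), 0 < ε →
    ∃ φ : G → ℂ, (Function.support φ).Finite ∧ HasCBNormBound φ (1 + ε) ∧
      ∀ g ∈ S, ‖φ g - 1‖ < ε

/-! ## Graph products -/

section GraphProd

variable {V : Type} (Γ : SimpleGraph V) (G : V → Type) [∀ v, Group (G v)]

/-- The commutators `[G_v, G_w]` over the edges of `Γ`. -/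
def commRels : Set (Monoid.CoprodI G) :=
  {x | ∃ (v w : V) (a : G v) (b : G w), Γ.Adj v w ∧
    x = ⁅Monoid.CoprodI.of a, Monoid.CoprodI.of b⁆}

/-- The graph product of the groups `G v` over the graph `Γ`. -/
abbrev GraphProduct :=
  Monoid.CoprodI G ⧸ Subgroup.normalClosure (commRels Γ G)

/-- The image in the graph product of a syllable, i.e. an element of a vertex group. -/
def ofSyl (s : (v : V) × G v) : GraphProduct Γ G :=
  QuotientGroup.mk (Monoid.CoprodI.of s.2)

/-- The element of the graph product represented by a formal word of syllables. -/
def wordProd (w : List ((v : V) × G v)) : GraphProduct Γ G :=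
  (w.map (ofSyl Γ G)).prod

/-- `w` is a formal word of nontrivial syllables representing `g`. -/
def IsWordOf (w : List ((v : V) × G v)) (g : GraphProduct Γ G) : Prop :=
  (∀ s ∈ w, s.2 ≠ 1) ∧ wordProd Γ G w = g

/-- The reduced word length `|g|_r`. -/
noncomputable def redLength (g : GraphProduct Γ G) : ℕ :=
  sInf {n | ∃ w, IsWordOf Γ G w g ∧ w.length = n}

/-- `w` is a reduced word representing `g` : a representing word of nontrivial syllables
of minimal syllable length. -/
def IsReducedWordOf (w : List ((v : V) × G v)) (g : GraphProduct Γ G) : Prop :=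
  IsWordOf Γ G w g ∧ ∀ w', IsWordOf Γ G w' g → w.length ≤ w'.length

/-- `κ`: the maximal number of mutually adjacent vertices of `Γ`. -/
noncomputable def kappa : ℕ :=
  sSup {n | ∃ s : Finset V, Γ.IsNClique n s}

/-- The `d`-tail of `g`: syllables appearing among the last `d` syllables of some reduced
word representing `g`. -/
def dTail (g : GraphProduct Γ G) (d : ℕ) : Set ((v : V) × G v) :=
  {s | ∃ w, IsReducedWordOf Γ G w g ∧ s ∈ w.drop (w.length - d)}

/-- `g` begins with `G_v`. -/
def BeginsWith (g : GraphProduct Γ G) (v : V) : Prop :=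
  ∃ w s, IsReducedWordOf Γ G w g ∧ w.head? = some s ∧ s.1 = v

/-- `g` ends with `G(lk(v))`: some reduced word for `g` has last syllable in a vertex
group adjacent to `v`. -/
def EndsWithLink (g : GraphProduct Γ G) (v : V) : Prop :=
  ∃ w s, IsReducedWordOf Γ G w g ∧ w.getLast? = some s ∧ Γ.Adj s.1 v

/-- The half-space `𝔸_v` of elements beginning with `G_v`. -/
noncomputable def halfSpace (v : V) : Set (GraphProduct Γ G) :=
  {g | ∃ gv : G v, redLength Γ G (ofSyl Γ G ⟨v, gv⟩ * g) < redLength Γ G g}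

/-- Left translate `k • s` of a subset of the graph product. -/
def wallTrans (k : GraphProduct Γ G) (s : Set (GraphProduct Γ G)) : Set (GraphProduct Γ G) :=
  (fun x => k * x) '' s

/-- Two walls (given by their preferred half-spaces) cross if all four intersections of
half-spaces are nonempty. -/
def Cross {X : Type} (s t : Set X) : Prop :=
  (s ∩ t).Nonempty ∧ (s ∩ tᶜ).Nonempty ∧ (sᶜ ∩ t).Nonempty ∧ (sᶜ ∩ tᶜ).Nonempty

/-- The set of walls `𝕎 = {k𝔸_v}`. -/
noncomputable def Walls : Set (Set (GraphProduct Γ G)) :=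
  {s | ∃ (k : GraphProduct Γ G) (v : V), s = wallTrans Γ G k (halfSpace Γ G v)}

/-- The wall (pseudo)distance: the number of walls separating `x` and `y`. -/
noncomputable def wallDist (x y : GraphProduct Γ G) : ℕ :=
  {s | s ∈ Walls Γ G ∧ Xor' (x ∈ s) (y ∈ s)}.ncard

end GraphProd


/-- The image in the free product `A ∗ B` of a syllable. -/
def sylEmb (A B : Type) [Group A] [Group B] : A ⊕ B → Monoid.Coprod A B :=
  Sum.elim (fun a => Monoid.Coprod.inl a) (fun b => Monoid.Coprod.inr b)


/-- normalized kernel bound -/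
def KB {X : Type} (k : X → X → ℂ) (C : ℝ) : Prop :=
  ∃ (H : Type) (_ : NormedAddCommGroup H) (_ : InnerProductSpace ℂ H)
    (α β : X → H), (∀ g, ‖α g‖ ^ 2 ≤ C) ∧ (∀ h, ‖β h‖ ^ 2 ≤ C) ∧
      ∀ g h, k g h = (inner ℂ (α g) (β h) : ℂ)

lemma KB.mono {X : Type} {k : X → X → ℂ} {C D : ℝ} (h : KB k C) (hCD : C ≤ D) : KB k D := by
  obtain ⟨H, i1, i2, α, β, h1, h2, h3⟩ := h
  exact ⟨H, i1, i2, α, β, fun g => (h1 g).trans hCD, fun g => (h2 g).trans hCD, h3⟩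

lemma KB.pullback {X Y : Type} {k : X → X → ℂ} {C : ℝ} (h : KB k C) (f : Y → X) :
    KB (fun g h => k (f g) (f h)) C := by
  obtain ⟨H, i1, i2, α, β, h1, h2, h3⟩ := h
  exact ⟨H, i1, i2, α ∘ f, β ∘ f, fun g => h1 _, fun g => h2 _, fun g h => h3 _ _⟩

lemma KB.l2 {X Y : Type} (H : Y → Type) [∀ y, NormedAddCommGroup (H y)]
    [∀ y, InnerProductSpace ℂ (H y)] (a b : X → ∀ y, H y) (C : ℝ)
    (ha : ∀ g, ∃ c, c ≤ C ∧ HasSum (fun y => ‖a g y‖ ^ 2) c)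
    (hb : ∀ g, ∃ c, c ≤ C ∧ HasSum (fun y => ‖b g y‖ ^ 2) c)
    (k : X → X → ℂ)
    (hk : ∀ g h, HasSum (fun y => (inner ℂ (a g y) (b h y) : ℂ)) (k g h)) : KB k C := by
  have hm : ∀ a : X → ∀ y, H y, (∀ g, ∃ c, c ≤ C ∧ HasSum (fun y => ‖a g y‖ ^ 2) c) →
      ∀ g, Memℓp (a g) 2 := by
    intro a ha g
    obtain ⟨c, -, hc⟩ := ha g
    refine memℓp_gen ?_
    simpa using hc.summable
  have hn : ∀ a : X → ∀ y, H y, (∀ g, ∃ c, c ≤ C ∧ HasSum (fun y => ‖a g y‖ ^ 2) c) →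
      ∀ g (hg : Memℓp (a g) 2), ‖(⟨a g, hg⟩ : lp H 2)‖ ^ 2 ≤ C := by
    intro a ha g hg
    obtain ⟨c, hcC, hc⟩ := ha g
    have := lp.norm_rpow_eq_tsum (p := 2) (by norm_num) (⟨a g, hg⟩ : lp H 2)
    simp only [ENNReal.toReal_ofNat, Real.rpow_ofNat] at this
    rw [this]
    rw [hc.tsum_eq]
    exact hcC
  refine ⟨lp H 2, inferInstance, inferInstance, fun g => ⟨a g, hm a ha g⟩,
    fun g => ⟨b g, hm b hb g⟩, fun g => hn a ha g _, fun g => hn b hb g _, fun g h => ?_⟩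
  rw [lp.inner_eq_tsum]
  exact (hk g h).tsum_eq.symm

lemma KB.hasSum {X ι : Type} (k : ι → X → X → ℂ) (C : ι → ℝ) (h : ∀ i, KB (k i) (C i))
    {c : ℝ} (hC : HasSum C c) (K : X → X → ℂ) (hK : ∀ g h, HasSum (fun i => k i g h) (K g h)) :
    KB K c := by
  choose H i1 i2 α β h1 h2 h3 using h
  refine KB.l2 H (fun g i => α i g) (fun g i => β i g) c (fun g => ?_) (fun g => ?_) K
    (fun g h => ?_)
  · have hs : Summable (fun i => ‖α i g‖ ^ 2) :=
      Summable.of_nonneg_of_le (fun i => by positivity) (fun i => h1 i g) hC.summable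
    exact ⟨_, hasSum_le (fun i => h1 i g) hs.hasSum hC, hs.hasSum⟩
  · have hs : Summable (fun i => ‖β i g‖ ^ 2) :=
      Summable.of_nonneg_of_le (fun i => by positivity) (fun i => h2 i g) hC.summable
    exact ⟨_, hasSum_le (fun i => h2 i g) hs.hasSum hC, hs.hasSum⟩
  · simpa only [h3] using hK g h

lemma KB.sum {X ι : Type} (s : Finset ι) (k : ι → X → X → ℂ) (C : ι → ℝ)
    (h : ∀ i ∈ s, KB (k i) (C i)) : KB (fun g h => ∑ i ∈ s, k i g h) (∑ i ∈ s, C i) := by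
  refine KB.hasSum (ι := s) (fun i => k i) (fun i => C i) (fun i => h i i.2) (c := ∑ i ∈ s, C i)
    ?_ _ (fun g h => ?_)
  · rw [← Finset.sum_coe_sort]; exact hasSum_fintype _
  · rw [← Finset.sum_coe_sort]; exact hasSum_fintype _

lemma KB.add {X : Type} {k k' : X → X → ℂ} {C C' : ℝ} (h : KB k C) (h' : KB k' C') :
    KB (fun g h => k g h + k' g h) (C + C') := by
  have := KB.sum (Finset.univ : Finset Bool) (fun b => if b then k else k')
    (fun b => if b then C else C') (by intro b _; cases b <;> simpa)
  simpa using this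

lemma KB.mul {X : Type} {k k' : X → X → ℂ} {C C' : ℝ} (h : KB k C) (h' : KB k' C') :
    KB (fun g h => k g h * k' g h) (C * C') := by
  obtain ⟨H, i1, i2, α, β, h1, h2, h3⟩ := h
  obtain ⟨H', i1', i2', α', β', h1', h2', h3'⟩ := h'
  refine ⟨TensorProduct ℂ H H', inferInstance, inferInstance,
    fun g => α g ⊗ₜ α' g, fun g => β g ⊗ₜ β' g, fun g => ?_, fun g => ?_, fun g h => ?_⟩
  · rw [TensorProduct.norm_tmul, mul_pow]
    exact mul_le_mul (h1 g) (h1' g) (by positivity) ((by positivity : 0 ≤ ‖α g‖ ^ 2).trans (h1 g))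
  · rw [TensorProduct.norm_tmul, mul_pow]
    exact mul_le_mul (h2 g) (h2' g) (by positivity) ((by positivity : 0 ≤ ‖β g‖ ^ 2).trans (h2 g))
  · rw [TensorProduct.inner_tmul, ← h3, ← h3']

lemma KB.rankOne {X : Type} (u w : X → ℂ) (C : ℝ) (hu : ∀ g, ‖u g‖ ^ 2 ≤ C)
    (hw : ∀ g, ‖w g‖ ^ 2 ≤ C) : KB (fun g h => u g * w h) C := by
  refine ⟨ℂ, inferInstance, inferInstance, fun g => (starRingEnd ℂ) (u g), w, fun g => ?_, hw,
    fun g h => ?_⟩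
  · simpa using hu g
  · simp [mul_comm]

lemma KB.const {X : Type} (z : ℂ) {C : ℝ} (hz : ‖z‖ ≤ C) : KB (fun _ _ : X => z) C := by
  obtain ⟨s, hs⟩ : ∃ s : ℂ, s ^ 2 = z := IsAlgClosed.exists_pow_nat_eq z two_pos
  have h2 : ‖s‖ ^ 2 = ‖z‖ := by rw [← norm_pow, hs]
  have := KB.rankOne (X := X) (fun _ => s) (fun _ => s) C (fun _ => by rw [h2]; exact hz)
    (fun _ => by rw [h2]; exact hz)
  simpa [← sq, hs] using this

lemma KB.smul {X : Type} {k : X → X → ℂ} {C : ℝ} (h : KB k C) (z : ℂ) :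
    KB (fun g h => z * k g h) (‖z‖ * C) := KB.mul (KB.const z le_rfl) h

lemma KB.finprod {X ι : Type} (s : Finset ι) (k : ι → X → X → ℂ) (C : ι → ℝ)
    (h : ∀ i ∈ s, KB (k i) (C i)) : KB (fun g h => ∏ i ∈ s, k i g h) (∏ i ∈ s, C i) := by
  classical
  induction s using Finset.induction_on with
  | empty => simpa using KB.const (X := X) (1 : ℂ) (C := 1) (by simp)
  | insert a s ha ih =>
    simp only [Finset.prod_insert ha]
    exact KB.mul (h a (by simp)) (ih (fun i hi => h i (by simp [hi])))

lemma KB.eqKernel {X : Type} [DecidableEq X] : KB (fun g h : X => if g = h then (1:ℂ) else 0) 1 := by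
  refine KB.l2 (Y := X) (fun _ => ℂ) (fun g y => if y = g then 1 else 0)
    (fun g y => if y = g then 1 else 0) 1 (fun g => ⟨1, le_rfl, ?_⟩) (fun g => ⟨1, le_rfl, ?_⟩) _
    (fun g h => ?_)
  · convert hasSum_ite_eq g (1:ℝ) using 2 with y
    split_ifs <;> simp
  · convert hasSum_ite_eq g (1:ℝ) using 2 with y
    split_ifs <;> simp
  · convert hasSum_ite_eq g (if g = h then (1:ℂ) else 0) using 2 with y
    by_cases hy : y = g
    · subst hy; simp
    · simp [hy]

lemma KB.of_cb {G : Type} [Group G] {φ : G → ℂ} {C : ℝ} (h : HasCBNormBound φ C) (hC : 0 ≤ C) :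
    KB (fun g h => φ (h⁻¹ * g)) C := by
  obtain ⟨H, i1, i2, α, β, Ca, Cb, h1, h2, h3, h4⟩ := h
  have ha : 0 ≤ Ca := (norm_nonneg _).trans (h1 1)
  have hb : 0 ≤ Cb := (norm_nonneg _).trans (h2 1)
  rcases ha.eq_or_lt with ha | ha
  · refine ⟨H, i1, i2, fun _ => 0, fun _ => 0, by simpa, by simpa, fun g h => ?_⟩
    have : α g = 0 := norm_le_zero_iff.1 (by simpa [← ha] using h1 g)
    simp [h4, this]
  rcases hb.eq_or_lt with hb | hb
  · refine ⟨H, i1, i2, fun _ => 0, fun _ => 0, by simpa, by simpa, fun g h => ?_⟩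
    have : β h = 0 := norm_le_zero_iff.1 (by simpa [← hb] using h2 h)
    simp [h4, this]
  set t : ℝ := Real.sqrt (Cb / Ca) with ht
  have ht0 : 0 < t := Real.sqrt_pos.2 (by positivity)
  have ht2 : t ^ 2 = Cb / Ca := Real.sq_sqrt (by positivity)
  refine ⟨H, i1, i2, fun g => (t:ℂ) • α g, fun g => ((t⁻¹:ℝ):ℂ) • β g, fun g => ?_, fun g => ?_,
    fun g h => ?_⟩
  · rw [norm_smul, mul_pow]
    simp only [Complex.norm_real, Real.norm_eq_abs, sq_abs, ht2]
    refine le_trans ?_ h3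
    calc Cb / Ca * ‖α g‖ ^ 2 ≤ Cb / Ca * Ca ^ 2 := by gcongr; exact h1 g
      _ = Ca * Cb := by field_simp
  · rw [norm_smul, mul_pow]
    simp only [Complex.norm_real, Real.norm_eq_abs, sq_abs, inv_pow, ht2]
    refine le_trans ?_ h3
    calc (Cb / Ca)⁻¹ * ‖β g‖ ^ 2 ≤ (Cb / Ca)⁻¹ * Cb ^ 2 := by gcongr; exact h2 g
      _ = Ca * Cb := by field_simp
  · rw [inner_smul_left, inner_smul_right, ← h4]
    simp only [Complex.conj_ofReal, Complex.ofReal_inv]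
    rw [← mul_assoc, mul_inv_cancel₀ (by exact_mod_cast ht0.ne'), one_mul]

lemma KB.to_cb {G : Type} [Group G] {φ : G → ℂ} {C : ℝ} (h : KB (fun g h => φ (h⁻¹ * g)) C) :
    HasCBNormBound φ C := by
  obtain ⟨H, i1, i2, α, β, h1, h2, h3⟩ := h
  have hC : 0 ≤ C := le_trans (by positivity) (h1 1)
  refine ⟨H, i1, i2, α, β, Real.sqrt C, Real.sqrt C, fun g => ?_, fun g => ?_, ?_, h3⟩
  · exact Real.le_sqrt_of_sq_le (h1 g)
  · exact Real.le_sqrt_of_sq_le (h2 g)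
  · rw [Real.mul_self_sqrt hC]

lemma KB.norm_le {X : Type} {k : X → X → ℂ} {C : ℝ} (h : KB k C) (g h' : X) : ‖k g h'‖ ≤ C := by
  obtain ⟨H, i1, i2, α, β, h1, h2, h3⟩ := h
  rw [h3]
  refine (norm_inner_le_norm _ _).trans ?_
  nlinarith [h1 g, h2 h', sq_nonneg (‖α g‖ - ‖β h'‖)]

section FreeProd
open Monoid
open Classical in
/-- tree kernel -/
noncomputable def Kern {I B : Type} (κ : B → List (Σ _ : I, B) → B → List (Σ _ : I, B) → ℂ) :
    List (Σ _ : I, B) → List (Σ _ : I, B) → ℂ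
  | s :: t, s' :: t' => (if s.1 = s'.1 then κ s.2 t s'.2 t' else 0) +
      (if s = s' then Kern κ t t' else 0)
  | [], _ => 0
  | _ :: _, [] => 0

open Classical in
/-- node vectors -/
noncomputable def nodeV {I B H : Type} [Zero H] (A : B → List (Σ _ : I, B) → H) :
    List (Σ _ : I, B) → (List (Σ _ : I, B) × I) → H
  | [], _ => 0
  | s :: t, ([], i) => if i = s.1 then A s.2 t else 0
  | s :: t, (x :: p, i) => if x = s then nodeV A t (p, i) else 0

/-- sum over suffixes -/
def sufSum {I B : Type} (N : B → List (Σ _ : I, B) → ℝ) : List (Σ _ : I, B) → ℝ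
  | [] => 0
  | s :: t => N s.2 t + sufSum N t

variable {I B : Type}

lemma hasSum_node {H : Type} [NormedAddCommGroup H] [InnerProductSpace ℂ H]
    (A A' : B → List (Σ _ : I, B) → H) (l m : List (Σ _ : I, B)) :
    HasSum (fun y => (inner ℂ (nodeV A l y) (nodeV A' m y) : ℂ))
      (Kern (fun b t c t' => inner ℂ (A b t) (A' c t')) l m) := by
  classical
  induction l generalizing m with
  | nil => simp [nodeV, Kern]
  | cons s t ih =>
    cases m with
    | nil => simp [nodeV, Kern]
    | cons s' t' =>
      rw [Kern]
      have h1 := hasSum_ite_eq (([] : List (Σ _ : I, B)), s.1)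
        (if s.1 = s'.1 then (inner ℂ (A s.2 t) (A' s'.2 t') : ℂ) else 0)
      have hinj : Function.Injective
          (fun y : List (Σ _ : I, B) × I => ((s :: y.1, y.2) : List (Σ _ : I, B) × I)) := by
        rintro ⟨a, b⟩ ⟨c, d⟩ h
        simpa using h
      let f2 : List (Σ _ : I, B) × I → ℂ := fun y => match y with
        | ([], _) => 0
        | (x :: p, i) => if x = s ∧ s = s' then
            (inner ℂ (nodeV A t (p, i)) (nodeV A' t' (p, i)) : ℂ) else 0
      have h2 : HasSum f2
          (if s = s' then Kern (fun b t c t' => inner ℂ (A b t) (A' c t')) t t' else 0) := by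
        rw [← hinj.hasSum_iff]
        · by_cases hs : s = s'
          · have := ih t'
            simpa [f2, hs, Function.comp_def] using this
          · simp [f2, hs, Function.comp_def]
        · rintro ⟨_ | ⟨x, p⟩, i⟩ hx
          · rfl
          · have : x ≠ s := by
              rintro rfl
              exact hx ⟨(p, i), rfl⟩
            simp [f2, this]
      convert h1.add h2 using 2 with y
      obtain ⟨_ | ⟨x, p⟩, i⟩ := y
      · by_cases hi : i = s.1
        · subst hi
          simp only [nodeV, f2]
          split_ifs <;> simp
        · simp [nodeV, f2, hi]
      · by_cases hx : x = s
        · subst hx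
          simp only [nodeV, f2]
          split_ifs <;> simp_all
        · simp [nodeV, f2, hx]

lemma kern_diag {H : Type} [NormedAddCommGroup H] [InnerProductSpace ℂ H]
    (A : B → List (Σ _ : I, B) → H) (l : List (Σ _ : I, B)) :
    Kern (fun b t c t' => (inner ℂ (A b t) (A c t') : ℂ)) l l
      = ((sufSum (fun b t => ‖A b t‖ ^ 2) l : ℝ) : ℂ) := by
  induction l with
  | nil => simp [Kern, sufSum]
  | cons s t ih => simp [Kern, sufSum, ih, inner_self_eq_norm_sq_to_K]

lemma hasSum_node_sq {H : Type} [NormedAddCommGroup H] [InnerProductSpace ℂ H]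
    (A : B → List (Σ _ : I, B) → H) (l : List (Σ _ : I, B)) :
    HasSum (fun y => ‖nodeV A l y‖ ^ 2) (sufSum (fun b t => ‖A b t‖ ^ 2) l) := by
  have h := hasSum_node A A l l
  rw [kern_diag] at h
  have h2 := Complex.hasSum_re h
  simp only [inner_self_eq_norm_sq_to_K] at h2
  have h3 : (fun y => ‖nodeV A l y‖ ^ 2) = fun y => ((((‖nodeV A l y‖ : ℝ) : ℂ)) ^ 2).re := by
    funext y
    norm_cast
  rw [h3]
  exact h2

lemma KB_kern {X : Type} (w : X → List (Σ _ : I, B))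
    {H : Type} [NormedAddCommGroup H] [InnerProductSpace ℂ H]
    (A A' : B → List (Σ _ : I, B) → H) (C : ℝ)
    (hA : ∀ g, sufSum (fun b t => ‖A b t‖ ^ 2) (w g) ≤ C)
    (hA' : ∀ g, sufSum (fun b t => ‖A' b t‖ ^ 2) (w g) ≤ C) :
    KB (fun g h => Kern (fun b t c t' => inner ℂ (A b t) (A' c t')) (w g) (w h)) C :=
  KB.l2 (fun _ => H) (fun g => nodeV A (w g)) (fun g => nodeV A' (w g)) C
    (fun g => ⟨_, hA g, hasSum_node_sq A _⟩) (fun g => ⟨_, hA' g, hasSum_node_sq A' _⟩) _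
    (fun _ _ => hasSum_node A A' _ _)

lemma KB_kern_root {X : Type} (w : X → List (Σ _ : I, B))
    {H : Type} [NormedAddCommGroup H] [InnerProductSpace ℂ H]
    (A A' : B → List (Σ _ : I, B) → H) (u u' : X → ℂ) (C : ℝ)
    (hA : ∀ g, sufSum (fun b t => ‖A b t‖ ^ 2) (w g) + ‖u g‖ ^ 2 ≤ C)
    (hA' : ∀ g, sufSum (fun b t => ‖A' b t‖ ^ 2) (w g) + ‖u' g‖ ^ 2 ≤ C) :
    KB (fun g h => Kern (fun b t c t' => inner ℂ (A b t) (A' c t')) (w g) (w h) + u g * u' h) C := by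
  have hm : ∀ (A : B → List (Σ _ : I, B) → H) g, Memℓp (nodeV A (w g)) 2 := by
    intro A g
    refine memℓp_gen ?_
    simpa using (hasSum_node_sq A (w g)).summable
  have hn : ∀ (A : B → List (Σ _ : I, B) → H) g,
      ‖(⟨nodeV A (w g), hm A g⟩ : lp (fun _ : List (Σ _ : I, B) × I => H) 2)‖ ^ 2
        = sufSum (fun b t => ‖A b t‖ ^ 2) (w g) := by
    intro A g
    have := lp.norm_rpow_eq_tsum (p := 2) (by norm_num)
      (⟨nodeV A (w g), hm A g⟩ : lp (fun _ : List (Σ _ : I, B) × I => H) 2)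
    simp only [ENNReal.toReal_ofNat, Real.rpow_ofNat] at this
    rw [this, (hasSum_node_sq A (w g)).tsum_eq]
  refine ⟨WithLp 2 (lp (fun _ : List (Σ _ : I, B) × I => H) 2 × ℂ), inferInstance, inferInstance,
    fun g => WithLp.toLp 2 (⟨nodeV A (w g), hm A g⟩, (starRingEnd ℂ) (u g)),
    fun g => WithLp.toLp 2 (⟨nodeV A' (w g), hm A' g⟩, u' g), fun g => ?_, fun g => ?_,
    fun g h => ?_⟩
  · rw [WithLp.prod_norm_sq_eq_of_L2]
    simpa [hn] using hA g
  · rw [WithLp.prod_norm_sq_eq_of_L2]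
    simpa [hn] using hA' g
  · rw [WithLp.prod_inner_apply]
    simp only [lp.inner_eq_tsum]
    rw [(hasSum_node A A' (w g) (w h)).tsum_eq]
    simp [mul_comm]

variable [Group B]

/-- reduced lists -/
def Red (l : List (Σ _ : I, B)) : Prop :=
  (∀ s ∈ l, s.2 ≠ 1) ∧ l.IsChain (fun a b => a.1 ≠ b.1)

/-- product -/
def lprod (l : List (Σ _ : I, B)) : CoprodI (fun _ : I => B) :=
  (l.map (fun s => CoprodI.of (M := fun _ : I => B) (i := s.1) s.2)).prod

open Classical in
/-- reduced word -/
noncomputable def wd (g : CoprodI (fun _ : I => B)) : List (Σ _ : I, B) :=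
  (CoprodI.Word.equiv g).toList

lemma red_wd (g : CoprodI (fun _ : I => B)) : Red (wd g) := by
  classical
  exact ⟨(CoprodI.Word.equiv g).ne_one, (CoprodI.Word.equiv g).chain_ne⟩

lemma lprod_wd (g : CoprodI (fun _ : I => B)) : lprod (wd g) = g := by
  classical
  exact CoprodI.Word.equiv.symm_apply_apply g

lemma wd_lprod {l : List (Σ _ : I, B)} (h : Red l) : wd (lprod l) = l := by
  classical
  exact congrArg CoprodI.Word.toList (CoprodI.Word.equiv.apply_symm_apply (⟨l, h.1, h.2⟩ : CoprodI.Word _))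

/-- inverse list -/
def revinv (l : List (Σ _ : I, B)) : List (Σ _ : I, B) :=
  (l.map (fun s => (⟨s.1, s.2⁻¹⟩ : Σ _ : I, B))).reverse

lemma lprod_append (l m : List (Σ _ : I, B)) : lprod (l ++ m) = lprod l * lprod m := by
  simp [lprod]

lemma lprod_cons (s : Σ _ : I, B) (m : List (Σ _ : I, B)) :
    lprod (s :: m) = CoprodI.of (M := fun _ : I => B) (i := s.1) s.2 * lprod m := by
  simp [lprod]

lemma revinv_cons (s : Σ _ : I, B) (m : List (Σ _ : I, B)) :
    revinv (s :: m) = revinv m ++ [⟨s.1, s.2⁻¹⟩] := by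
  simp [revinv]

lemma lprod_revinv (l : List (Σ _ : I, B)) : lprod (revinv l) = (lprod l)⁻¹ := by
  induction l with
  | nil => simp [lprod, revinv]
  | cons s t ih =>
    rw [revinv_cons, lprod_append, ih, lprod_cons s t, mul_inv_rev]
    simp [lprod]

lemma red_revinv {l : List (Σ _ : I, B)} (h : Red l) : Red (revinv l) := by
  refine ⟨?_, ?_⟩
  · intro s hs
    simp only [revinv, List.mem_reverse, List.mem_map] at hs
    obtain ⟨a, ha, rfl⟩ := hs
    simpa using h.1 a ha
  · rw [revinv, List.isChain_reverse, List.isChain_map]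
    exact h.2.imp (fun a b hab => fun h => hab h.symm)

lemma Red.tail {s : Σ _ : I, B} {t : List (Σ _ : I, B)} (h : Red (s :: t)) : Red t :=
  ⟨fun x hx => h.1 x (by simp [hx]), h.2.tail⟩

/-- weights -/
def Wt (φ : B → ℂ) (l : List (Σ _ : I, B)) : ℂ := (l.map (fun s => φ s.2)).prod
/-- weights -/
def Wt' (φ : B → ℂ) (l : List (Σ _ : I, B)) : ℂ := (l.map (fun s => φ s.2⁻¹)).prod

/-- value -/
def Fval (p : ℕ → ℂ) (φ : B → ℂ) (l : List (Σ _ : I, B)) : ℂ := p l.length * Wt φ l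

/-- value function -/
noncomputable def Ffun (p : ℕ → ℂ) (φ : B → ℂ) (g : CoprodI (fun _ : I => B)) : ℂ := Fval p φ (wd g)

lemma Wt_revinv (φ : B → ℂ) (l : List (Σ _ : I, B)) : Wt φ (revinv l) = Wt' φ l := by
  simp [Wt, Wt', revinv, List.prod_reverse, Function.comp_def]

lemma Wt_append (φ : B → ℂ) (l m : List (Σ _ : I, B)) : Wt φ (l ++ m) = Wt φ l * Wt φ m := by
  simp [Wt]

open Classical in
/-- the node kernel -/
noncomputable def kap (p : ℕ → ℂ) (φ : B → ℂ) (b : B) (t : List (Σ _ : I, B)) (c : B)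
    (t' : List (Σ _ : I, B)) : ℂ :=
  Wt φ t * Wt' φ t' * ((if b = c then p (t.length + t'.length) else p (t.length + t'.length + 1))
    * φ (c⁻¹ * b) - p (t.length + t'.length + 2) * (φ b * φ c⁻¹))

lemma Ffun_eq (p : ℕ → ℂ) (φ : B → ℂ) (h1 : φ 1 = 1) (l m : List (Σ _ : I, B)) (hl : Red l)
    (hm : Red m) : Ffun p φ ((lprod m)⁻¹ * lprod l) =
      Kern (kap p φ) l m + p (l.length + m.length) * (Wt φ l * Wt' φ m) := by
  classical
  induction l generalizing m with
  | nil =>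
    rw [← lprod_revinv, show lprod ([] : List (Σ _ : I, B)) = 1 from rfl, mul_one, Ffun,
      wd_lprod (red_revinv hm), Fval, Wt_revinv]
    simp [Kern, Wt, revinv]
  | cons s t ih =>
    cases m with
    | nil =>
      rw [show lprod ([] : List (Σ _ : I, B)) = 1 from rfl, inv_one, one_mul, Ffun,
        wd_lprod hl, Fval]
      simp [Kern, Wt']
    | cons s' t' =>
      have hW : Wt φ (s :: t) = φ s.2 * Wt φ t := by simp [Wt]
      have hW' : Wt' φ (s' :: t') = φ s'.2⁻¹ * Wt' φ t' := by simp [Wt']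
      have hlen : (s :: t).length + (s' :: t').length = t.length + t'.length + 2 := by
        simp; ring
      rw [hW, hW', hlen, Kern]
      by_cases hs : s = s'
      · subst hs
        rw [lprod_cons, lprod_cons, mul_inv_rev, mul_assoc, inv_mul_cancel_left,
          ih t' hl.tail hm.tail]
        simp [kap, h1]
        ring
      · by_cases hi : s.1 = s'.1
        · obtain ⟨i, b⟩ := s
          obtain ⟨i', c⟩ := s'
          simp only at hi
          subst hi
          have hbc : b ≠ c := by rintro rfl; exact hs rfl
          have hprod : (lprod (⟨i, c⟩ :: t'))⁻¹ * lprod (⟨i, b⟩ :: t) =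
              lprod (revinv t' ++ ⟨i, c⁻¹ * b⟩ :: t) := by
            rw [lprod_append, lprod_revinv, lprod_cons, lprod_cons, lprod_cons]
            simp [mul_assoc]
          have hred : Red (revinv t' ++ ⟨i, c⁻¹ * b⟩ :: t) := by
            have hr := red_revinv hm
            rw [revinv_cons] at hr
            refine ⟨?_, ?_⟩
            · intro x hx
              simp only [List.mem_append, List.mem_cons] at hx
              rcases hx with hx | rfl | hx
              · exact hr.1 x (by simp [hx])
              · simpa [inv_mul_eq_one] using hbc.symm
              · exact hl.1 x (by simp [hx])
            · have h3 := hr.2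
              have h4 := hl.2
              rw [List.isChain_append] at h3 ⊢
              refine ⟨h3.1, ?_, ?_⟩
              · rw [List.isChain_cons] at h4 ⊢
                exact h4
              · simpa using h3.2.2
          rw [hprod, Ffun, wd_lprod hred, Fval, Wt_append, Wt_revinv]
          have hl2 : (revinv t' ++ (⟨i, c⁻¹ * b⟩ : Σ _ : I, B) :: t).length
            = t.length + t'.length + 1 := by simp [revinv]; ring
          rw [hl2]
          have : Wt φ ((⟨i, c⁻¹ * b⟩ : Σ _ : I, B) :: t) = φ (c⁻¹ * b) * Wt φ t := by simp [Wt]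
          rw [this]
          simp [kap, hbc]
          ring
        · have hred : Red (revinv (s' :: t') ++ s :: t) := by
            have hr := red_revinv hm
            refine ⟨?_, ?_⟩
            · intro x hx
              simp only [List.mem_append] at hx
              rcases hx with hx | hx
              · exact hr.1 x hx
              · exact hl.1 x hx
            · rw [List.isChain_append]
              refine ⟨hr.2, hl.2, ?_⟩
              rw [revinv_cons]
              simpa using fun h => hi h.symm
          rw [← lprod_revinv, ← lprod_append, Ffun, wd_lprod hred, Fval, Wt_append, Wt_revinv,
            hW, hW']
          have hl2 : (revinv (s' :: t') ++ s :: t).length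
            = t.length + t'.length + 2 := by simp [revinv]; ring
          rw [hl2, if_neg hi, if_neg hs]
          ring
end FreeProd

section Estimates
open Monoid
variable {I B : Type}

lemma vec_est {H : Type} [NormedAddCommGroup H] [InnerProductSpace ℂ H] (x e f : H) (τ : ℝ)
    (h0 : 0 ≤ τ) (h1 : τ ≤ 1) (hx : ‖x‖ ^ 2 ≤ 1 + τ ^ 2) (he : ‖e‖ ^ 2 ≤ 1 + τ ^ 2)
    (hf : ‖f‖ ^ 2 ≤ 1 + τ ^ 2) (hef : (inner ℂ e f : ℂ) = 1) (z : ℂ) (hz : (inner ℂ x f : ℂ) = z)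
    (hz1 : ‖z‖ ≤ 1) : ‖x - (starRingEnd ℂ) z • e‖ ^ 2 + ‖z‖ ^ 2 ≤ 1 + 6 * τ := by
  have h2 : ‖e - f‖ ^ 2 ≤ 2 * τ ^ 2 := by
    rw [norm_sub_sq (𝕜 := ℂ), hef]
    simp
    linarith
  have h3 : ‖x‖ * ‖e - f‖ ≤ 2 * τ := by
    refine abs_le_of_sq_le_sq ?_ (by positivity) |> (le_abs_self _).trans
    rw [mul_pow]
    have : ‖x‖ ^ 2 * ‖e - f‖ ^ 2 ≤ (1 + τ ^ 2) * (2 * τ ^ 2) :=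
      mul_le_mul hx h2 (by positivity) (by positivity)
    have ht : τ ^ 2 ≤ 1 := by nlinarith
    nlinarith [mul_nonneg (sq_nonneg τ) (sub_nonneg.2 ht)]
  have h4 : (inner ℂ x ((starRingEnd ℂ) z • e) : ℂ) = (‖z‖ ^ 2 : ℝ) +
      (starRingEnd ℂ) z * (inner ℂ x (e - f) : ℂ) := by
    rw [inner_smul_right, inner_sub_right, hz]
    have : ((‖z‖ ^ 2 : ℝ) : ℂ) = (starRingEnd ℂ) z * z := by
      rw [← Complex.normSq_eq_conj_mul_self, Complex.normSq_eq_norm_sq]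
    rw [this]; ring
  have h5 : ‖(starRingEnd ℂ) z * (inner ℂ x (e - f) : ℂ)‖ ≤ 2 * τ * ‖z‖ := by
    rw [norm_mul, RCLike.norm_conj, mul_comm]
    exact mul_le_mul_of_nonneg_right ((norm_inner_le_norm _ _).trans h3) (norm_nonneg _)
  have h6 := (abs_le.1 ((Complex.abs_re_le_norm _).trans h5)).1
  rw [norm_sub_sq (𝕜 := ℂ), h4, norm_smul, mul_pow, RCLike.norm_conj]
  simp only [RCLike.re_to_complex, Complex.add_re, Complex.ofReal_re]
  have h7 : ‖z‖ ^ 2 * ‖e‖ ^ 2 ≤ ‖z‖ ^ 2 * (1 + τ ^ 2) :=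
    mul_le_mul_of_nonneg_left he (by positivity)
  have h8 : ‖z‖ ^ 2 ≤ 1 := by nlinarith [norm_nonneg z]
  nlinarith [mul_nonneg h0 (sub_nonneg.2 hz1), mul_nonneg h0 (sub_nonneg.2 h1),
    mul_nonneg (sq_nonneg τ) (sub_nonneg.2 h8)]

lemma Wt_norm_le [Group B] (z : B → ℂ) (s : ℝ) (hs : 0 ≤ s) (hz : ∀ b, b ≠ 1 → ‖z b‖ ≤ s)
    (l : List (Σ _ : I, B)) (hl : Red l) : ‖Wt z l‖ ≤ s ^ l.length := by
  induction l with
  | nil => simp [Wt]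
  | cons x t ih =>
    have : Wt z (x :: t) = z x.2 * Wt z t := by simp [Wt]
    rw [this, norm_mul, List.length_cons, pow_succ, mul_comm]
    exact mul_le_mul (ih hl.tail) (hz _ (hl.1 x (by simp))) (norm_nonneg _) (by positivity)

lemma suf_est [Group B] {H : Type} [NormedAddCommGroup H] [InnerProductSpace ℂ H]
    (z : B → ℂ) (D : B → H) (s δ : ℝ) (hs : 0 ≤ s) (hs1 : s < 1) (hδ : 0 ≤ δ)
    (hz : ∀ b, b ≠ 1 → ‖z b‖ ≤ s) (hD : ∀ b, b ≠ 1 → ‖D b‖ ^ 2 + ‖z b‖ ^ 2 ≤ 1 + δ)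
    (A : B → List (Σ _ : I, B) → H) (hA : ∀ b t, ‖A b t‖ = ‖Wt z t‖ * ‖D b‖)
    (l : List (Σ _ : I, B)) (hl : Red l) :
    sufSum (fun b t => ‖A b t‖ ^ 2) l + ‖Wt z l‖ ^ 2 ≤ 1 + δ / (1 - s ^ 2) := by
  have hs2 : s ^ 2 < 1 := by nlinarith
  have key : sufSum (fun b t => ‖A b t‖ ^ 2) l + ‖Wt z l‖ ^ 2 ≤
      1 + δ * ((1 - (s ^ 2) ^ l.length) / (1 - s ^ 2)) := by
    induction l with
    | nil => simp [sufSum, Wt]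
    | cons x t ih =>
      have h1 : Wt z (x :: t) = z x.2 * Wt z t := by simp [Wt]
      have h2 := ih hl.tail
      have h3 := hD x.2 (hl.1 x (by simp))
      have h4 := Wt_norm_le z s hs hz t hl.tail
      have h5 : ‖Wt z t‖ ^ 2 ≤ (s ^ 2) ^ t.length := by
        rw [← pow_mul, mul_comm, pow_mul]; gcongr
      simp only [sufSum, hA]
      rw [h1, norm_mul]
      have h6 : (1 - (s ^ 2) ^ (x :: t).length) / (1 - s ^ 2) =
          (1 - (s ^ 2) ^ t.length) / (1 - s ^ 2) + (s ^ 2) ^ t.length := by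
        have : 1 - s ^ 2 ≠ 0 := by linarith
        rw [List.length_cons]
        field_simp
        ring
      rw [h6]
      simp only [hA] at h2
      have h7 : ‖Wt z t‖ ^ 2 * (‖D x.2‖ ^ 2 + ‖z x.2‖ ^ 2) ≤ ‖Wt z t‖ ^ 2 * (1 + δ) :=
        mul_le_mul_of_nonneg_left h3 (by positivity)
      have h8 : ‖Wt z t‖ ^ 2 * δ ≤ (s ^ 2) ^ t.length * δ := mul_le_mul_of_nonneg_right h5 hδ
      nlinarith
  refine key.trans ?_
  have h1 : (1 - (s ^ 2) ^ l.length) / (1 - s ^ 2) ≤ 1 / (1 - s ^ 2) := by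
    apply div_le_div_of_nonneg_right _ (by linarith)
    have : 0 ≤ (s ^ 2) ^ l.length := by positivity
    linarith
  have := mul_le_mul_of_nonneg_left h1 hδ
  rw [mul_one_div] at this
  linarith

lemma KB_main [Group B] (ψ : B → ℂ) (h1 : ψ 1 = 1) (τ s : ℝ) (h0 : 0 ≤ τ) (hτ : τ ≤ 1)
    (hψ : KB (fun g h => ψ (h⁻¹ * g)) (1 + τ ^ 2)) (hs : 0 ≤ s) (hs1 : s < 1)
    (hz : ∀ b, b ≠ 1 → ‖ψ b‖ ≤ s) :
    KB (fun g h : CoprodI (fun _ : I => B) => Ffun (fun _ => 1) ψ (h⁻¹ * g))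
      (1 + 6 * τ / (1 - s ^ 2)) := by
  obtain ⟨H, i1, i2, α, β, ha, hb, hab⟩ := hψ
  have e1 : (inner ℂ (α 1) (β 1) : ℂ) = 1 := by rw [← hab]; simp [h1]
  have e1' : (inner ℂ (β 1) (α 1) : ℂ) = 1 := by rw [← inner_conj_symm, e1]; simp
  have e2 : ∀ b, (inner ℂ (α b) (β 1) : ℂ) = ψ b := fun b => by rw [← hab]; simp
  have e3 : ∀ c, (inner ℂ (α 1) (β c) : ℂ) = ψ c⁻¹ := fun b => by rw [← hab]; simp
  have e3' : ∀ c, (inner ℂ (β c) (α 1) : ℂ) = (starRingEnd ℂ) (ψ c⁻¹) := fun b => by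
    rw [← inner_conj_symm, e3]
  let D : B → H := fun b => α b - (starRingEnd ℂ) (ψ b) • α 1
  let D' : B → H := fun c => β c - ψ c⁻¹ • β 1
  have hDD : ∀ b c, (inner ℂ (D b) (D' c) : ℂ) = ψ (c⁻¹ * b) - ψ b * ψ c⁻¹ := by
    intro b c
    simp only [D, D', inner_sub_left, inner_sub_right, inner_smul_left, inner_smul_right, e1, e2,
      e3, ← hab, RCLike.conj_conj]
    simp
  have hker : (fun b t c t' => (inner ℂ ((starRingEnd ℂ) (Wt ψ t) • D b) (Wt' ψ t' • D' c) : ℂ))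
      = kap (I := I) (fun _ => 1) ψ := by
    funext b t c t'
    rw [inner_smul_left, inner_smul_right, hDD]
    simp [kap]
    ring
  have := KB_kern_root (X := CoprodI (fun _ : I => B)) wd
    (fun b t => (starRingEnd ℂ) (Wt ψ t) • D b) (fun c t' => Wt' ψ t' • D' c)
    (fun g => Wt ψ (wd g)) (fun g => Wt' ψ (wd g)) (1 + 6 * τ / (1 - s ^ 2)) ?_ ?_
  · rw [hker] at this
    convert this using 3 with g h
    have h2 := Ffun_eq (fun _ => 1) ψ h1 (wd g) (wd h) (red_wd g) (red_wd h)
    rw [lprod_wd, lprod_wd] at h2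
    rw [h2]
    simp
  · intro g
    refine suf_est ψ D s (6 * τ) hs hs1 (by positivity) hz (fun b hb' => ?_) _ (fun b t => ?_) _
      (red_wd g)
    · exact vec_est _ _ _ τ h0 hτ (ha _) (ha _) (hb _) e1 _ (e2 b) ((hz b hb').trans hs1.le)
    · rw [norm_smul, RCLike.norm_conj]
  · intro g
    have hz' : ∀ b : B, b ≠ 1 → ‖ψ b⁻¹‖ ≤ s := fun b hb => hz _ (by simpa using hb)
    refine suf_est (fun b => ψ b⁻¹) D' s (6 * τ) hs hs1 (by positivity) hz'
      (fun b hb' => ?_) _ (fun b t => ?_) _ (red_wd g)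
    · have := vec_est (β b) (β 1) (α 1) τ h0 hτ (hb _) (hb _) (ha _) e1' _ (e3' b)
        (by simpa using (hz' b hb').trans hs1.le)
      simpa [D'] using this
    · rw [norm_smul]; rfl
end Estimates

section Tail
open Monoid
variable {I B : Type}

lemma Kern_sum {ι : Type} (s : Finset ι) (κ : ι → B → List (Σ _ : I, B) → B → List (Σ _ : I, B) → ℂ)
    (l m : List (Σ _ : I, B)) :
    Kern (fun b t c t' => ∑ i ∈ s, κ i b t c t') l m = ∑ i ∈ s, Kern (κ i) l m := by
  classical
  induction l generalizing m with
  | nil => simp [Kern]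
  | cons x t ih =>
    cases m with
    | nil => simp [Kern]
    | cons y t' =>
      simp only [Kern, ih, Finset.sum_add_distrib]
      congr 1
      · split_ifs <;> simp
      · split_ifs <;> simp

lemma sufSum_single [Group B] (N : B → List (Σ _ : I, B) → ℝ) (i : ℕ) (C : ℝ)
    (hN : ∀ b t, Red t → N b t ≤ if t.length = i then C else 0)
    (l : List (Σ _ : I, B)) (hl : Red l) : sufSum N l ≤ if i < l.length then C else 0 := by
  induction l with
  | nil => simp [sufSum]
  | cons x t ih =>
    have h1 := ih hl.tail
    have h2 := hN x.2 t hl.tail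
    simp only [sufSum, List.length_cons]
    split_ifs at h1 h2 ⊢ <;> first | linarith | omega

lemma KB_R [Group B] (φ : B → ℂ) (M : ℝ) (hφ : KB (fun g h => φ (h⁻¹ * g)) M)
    (p0 p1 p2 : ℂ) (h0 : ‖p0‖ ≤ 1) (h1 : ‖p1‖ ≤ 1) (h2 : ‖p2‖ ≤ 1) (hM : 0 ≤ M) [DecidableEq B] :
    KB (fun b c : B => p1 * φ (c⁻¹ * b) + (p0 - p1) * (if b = c then 1 else 0) +
      (- p2) * (φ b * φ c⁻¹)) (M + 2 + M ^ 2) := by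
  have hn : ∀ b, ‖φ b‖ ≤ M := fun b => by simpa using hφ.norm_le b 1
  have hsq : ∀ b, ‖φ b‖ ^ 2 ≤ M ^ 2 := fun b => by
    have := hn b; gcongr
  refine (((hφ.smul p1).add (KB.eqKernel.smul (p0 - p1))).add
    ((KB.rankOne φ (fun c => φ c⁻¹) (M ^ 2) hsq (fun b => hsq _)).smul (- p2))).mono ?_
  have h3 : ‖p0 - p1‖ ≤ 2 := (norm_sub_le _ _).trans (by linarith)
  rw [norm_neg]
  have h4 := mul_le_mul_of_nonneg_right h1 hM
  have h5 := mul_le_mul_of_nonneg_right h2 (sq_nonneg M)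
  linarith

lemma KB_tail [Group B] (φ : B → ℂ) (h1 : φ 1 = 1) (M : ℝ) (hM : 1 ≤ M)
    (hφ : KB (fun g h => φ (h⁻¹ * g)) M) (N : ℕ) (p : ℕ → ℂ) (hp : ∀ n, ‖p n‖ ≤ 1)
    (hpN : ∀ n, N < n → p n = 0) :
    KB (fun g h : CoprodI (fun _ : I => B) => Ffun p φ (h⁻¹ * g))
      (((N:ℝ) + 1) ^ 2 * (M ^ (2 * N) * (M + 2 + M ^ 2 + 1))) := by
  classical
  have hM0 : 0 ≤ M := by linarith
  have hn : ∀ b, ‖φ b‖ ≤ M := fun b => by simpa using hφ.norm_le b 1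
  have hW : ∀ l : List (Σ _ : I, B), Red l → ‖Wt φ l‖ ≤ M ^ l.length :=
    Wt_norm_le φ M hM0 (fun b _ => hn b)
  have hW' : ∀ l : List (Σ _ : I, B), Red l → ‖Wt' φ l‖ ≤ M ^ l.length :=
    Wt_norm_le (fun b => φ b⁻¹) M hM0 (fun b _ => hn _)
  have hsqM : ∀ (x : ℂ) (i : ℕ), i ≤ N → ‖x‖ ≤ M ^ i → ‖x‖ ^ 2 ≤ M ^ (2 * N) := by
    intro x i hi hx
    calc ‖x‖ ^ 2 ≤ (M ^ i) ^ 2 := by gcongr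
      _ = M ^ (2 * i) := by rw [← pow_mul, mul_comm]
      _ ≤ M ^ (2 * N) := pow_le_pow_right₀ hM (by omega)
  set s := (Finset.range (N + 1)) ×ˢ (Finset.range (N + 1)) with hs
  let κ : ℕ × ℕ → B → List (Σ _ : I, B) → B → List (Σ _ : I, B) → ℂ := fun ij b t c t' =>
    (if t.length = ij.1 then Wt φ t else 0) * (if t'.length = ij.2 then Wt' φ t' else 0) *
    (p (ij.1 + ij.2 + 1) * φ (c⁻¹ * b) + (p (ij.1 + ij.2) - p (ij.1 + ij.2 + 1))
      * (if b = c then 1 else 0) + (- p (ij.1 + ij.2 + 2)) * (φ b * φ c⁻¹))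
  have hsum : ∀ (n m : ℕ) (f : ℕ → ℕ → ℂ), (∀ i j, N < i + j → f i j = 0) →
      ∑ ij ∈ s, (if n = ij.1 then if m = ij.2 then f ij.1 ij.2 else 0 else 0) = f n m := by
    intro n m f hf
    rw [hs, Finset.sum_product]
    simp only []
    by_cases hn : n ∈ Finset.range (N + 1)
    · rw [Finset.sum_eq_single_of_mem n hn]
      · by_cases hm : m ∈ Finset.range (N + 1)
        · rw [Finset.sum_eq_single_of_mem m hm]
          · simp
          · intro b _ hb; simp [hb.symm]
        · rw [hf n m (by simp at hm; omega)]
          apply Finset.sum_eq_zero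
          intro b hb
          have : m ≠ b := by rintro rfl; exact hm hb
          simp [this]
      · intro b _ hb; simp [hb.symm]
    · rw [hf n m (by simp at hn; omega)]
      apply Finset.sum_eq_zero
      intro b hb
      have : n ≠ b := by rintro rfl; exact hn hb
      simp [this]
  have hκ : kap (I := I) p φ = fun b t c t' => ∑ ij ∈ s, κ ij b t c t' := by
    funext b t c t'
    have := hsum t.length t'.length (fun i j => Wt φ t * Wt' φ t' *
      (p (i + j + 1) * φ (c⁻¹ * b) + (p (i + j) - p (i + j + 1))
      * (if b = c then 1 else 0) + (- p (i + j + 2)) * (φ b * φ c⁻¹))) (by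
        intro i j hij
        simp [hpN _ hij, hpN (i + j + 1) (by omega), hpN (i + j + 2) (by omega)])
    refine Eq.trans ?_ (this.symm.trans ?_)
    · simp only [kap]
      by_cases hbc : b = c
      · subst hbc; simp only [if_true, inv_mul_cancel, h1]; ring
      · simp only [if_neg hbc]; ring
    · apply Finset.sum_congr rfl
      intro ij _
      simp only [κ]
      split_ifs <;> simp
  have hroot : ∀ l m : List (Σ _ : I, B), p (l.length + m.length) * (Wt φ l * Wt' φ m) =
      ∑ ij ∈ s, p (ij.1 + ij.2) * ((if l.length = ij.1 then Wt φ l else 0) *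
        (if m.length = ij.2 then Wt' φ m else 0)) := by
    intro l m
    have := hsum l.length m.length (fun i j => p (i + j) * (Wt φ l * Wt' φ m)) (by
      intro i j hij; simp [hpN _ hij])
    refine this.symm.trans ?_
    apply Finset.sum_congr rfl
    intro ij _
    split_ifs <;> simp
  have hF : (fun g h : CoprodI (fun _ : I => B) => Ffun p φ (h⁻¹ * g)) = fun g h =>
      ∑ ij ∈ s, (Kern (κ ij) (wd g) (wd h) + p (ij.1 + ij.2) *
        ((if (wd g).length = ij.1 then Wt φ (wd g) else 0) *
        (if (wd h).length = ij.2 then Wt' φ (wd h) else 0))) := by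
    funext g h
    have h2 := Ffun_eq p φ h1 (wd g) (wd h) (red_wd g) (red_wd h)
    rw [lprod_wd, lprod_wd] at h2
    rw [h2, hκ, Kern_sum, hroot, Finset.sum_add_distrib]
  rw [hF]
  have hC : ∑ ij ∈ s, (M ^ (2 * N) * (M + 2 + M ^ 2) + M ^ (2 * N)) =
      (((N:ℝ) + 1) ^ 2 * (M ^ (2 * N) * (M + 2 + M ^ 2 + 1))) := by
    rw [Finset.sum_const, hs, Finset.card_product, Finset.card_range]
    simp only [nsmul_eq_mul]
    push_cast
    ring
  rw [← hC]
  apply KB.sum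
  intro ij hij
  have hi : ij.1 ≤ N := by simp [hs] at hij; omega
  have hj : ij.2 ≤ N := by simp [hs] at hij; omega
  refine KB.add ?_ ?_
  · obtain ⟨H, i1, i2, α, β, ha, hb, hab⟩ := KB_R φ M hφ (p (ij.1 + ij.2)) (p (ij.1 + ij.2 + 1))
      (p (ij.1 + ij.2 + 2)) (hp _) (hp _) (hp _) hM0
    have hker : κ ij = fun b t c t' => (inner ℂ
        ((starRingEnd ℂ) (if t.length = ij.1 then Wt φ t else 0) • α b)
        ((if t'.length = ij.2 then Wt' φ t' else 0) • β c) : ℂ) := by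
      funext b t c t'
      rw [inner_smul_left, inner_smul_right, ← hab]
      simp only [κ, RCLike.conj_conj]
      ring
    rw [hker]
    have hD : 0 ≤ M ^ (2 * N) * (M + 2 + M ^ 2) := by positivity
    refine KB_kern wd (fun b t => (starRingEnd ℂ) (if t.length = ij.1 then Wt φ t else 0) • α b)
      (fun c t' => (if t'.length = ij.2 then Wt' φ t' else 0) • β c) _ (fun g => ?_) (fun g => ?_)
    · refine (sufSum_single _ ij.1 (M ^ (2 * N) * (M + 2 + M ^ 2)) ?_ _ (red_wd g)).trans ?_
      · intro b t ht
        rw [norm_smul, RCLike.norm_conj, mul_pow]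
        split_ifs with h
        · exact mul_le_mul (hsqM _ _ hi (h ▸ hW t ht)) (ha b) (by positivity) (by positivity)
        · simp
      · split_ifs
        · exact le_rfl
        · exact hD
    · refine (sufSum_single _ ij.2 (M ^ (2 * N) * (M + 2 + M ^ 2)) ?_ _ (red_wd g)).trans ?_
      · intro b t ht
        rw [norm_smul, mul_pow]
        split_ifs with h
        · exact mul_le_mul (hsqM _ _ hj (h ▸ hW' t ht)) (hb b) (by positivity) (by positivity)
        · simp
      · split_ifs
        · exact le_rfl
        · exact hD
  · have h2 := (KB.rankOne (X := CoprodI (fun _ : I => B))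
      (fun g => if (wd g).length = ij.1 then Wt φ (wd g) else 0)
      (fun h => if (wd h).length = ij.2 then Wt' φ (wd h) else 0) (M ^ (2 * N)) (fun g => ?_)
      (fun g => ?_)).smul (p (ij.1 + ij.2))
    · refine h2.mono ?_
      exact (mul_le_mul_of_nonneg_right (hp _) (by positivity)).trans (by rw [one_mul])
    · split_ifs with h
      · exact hsqM _ _ hi (h ▸ hW _ (red_wd g))
      · simp; positivity
    · split_ifs with h
      · exact hsqM _ _ hj (h ▸ hW' _ (red_wd g))
      · simp; positivity
end Tail

section Cutoff
open Monoid Filter Topology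
variable {I B : Type}

lemma hasSum_tail (d n : ℕ) (r : ℝ) (W : ℂ) :
    HasSum (fun N : ℕ => (-((r:ℂ) ^ (N + d + 1))) * ((if n = N + d + 1 then 1 else 0) * W))
      (if n ≤ d then 0 else - ((r:ℂ) ^ n * W)) := by
  split_ifs with h
  · have : (fun N : ℕ => (-((r:ℂ) ^ (N + d + 1))) * ((if n = N + d + 1 then 1 else 0) * W)) =
      fun _ => 0 := by
      funext N
      rw [if_neg (by omega)]; simp
    rw [this]
    exact hasSum_zero
  · have h2 : n = (n - d - 1) + d + 1 := by omega
    have := hasSum_single (f := fun N : ℕ => (-((r:ℂ) ^ (N + d + 1))) * ((if n = N + d + 1 then 1 else 0) * W))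
      (n - d - 1) (by
        intro b hb
        rw [if_neg (by omega)]; simp)
    simp only [← h2] at this
    simpa using this

lemma Wt_psi [Group B] (φ ψ : B → ℂ) (r : ℂ) (h : ∀ b, b ≠ 1 → ψ b = r * φ b)
    (l : List (Σ _ : I, B)) (hl : Red l) : Wt ψ l = r ^ l.length * Wt φ l := by
  induction l with
  | nil => simp [Wt]
  | cons x t ih =>
    have h1 : ∀ χ : B → ℂ, Wt χ (x :: t) = χ x.2 * Wt χ t := fun χ => by simp [Wt]
    rw [h1, h1, ih hl.tail, h _ (hl.1 x (by simp)), List.length_cons, pow_succ]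
    ring

lemma KB_cut [Group B] (φ : B → ℂ) (h1 : φ 1 = 1) (τ r : ℝ) (h0 : 0 ≤ τ) (hτ : τ ≤ 1)
    (hφ : KB (fun g h => φ (h⁻¹ * g)) (1 + τ ^ 2)) (hr : 0 < r) (hr1 : r < 1)
    (hrM : r * (1 + τ ^ 2) ^ 2 < 1) (η : ℝ) (hη : 0 < η) :
    ∃ d0 : ℕ, ∀ d ≥ d0, ∀ I : Type,
      KB (fun g h : CoprodI (fun _ : I => B) =>
        Ffun (fun n => if n ≤ d then (r:ℂ) ^ n else 0) φ (h⁻¹ * g))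
        (1 + 6 * τ / (1 - (r * (1 + τ ^ 2)) ^ 2) + η) := by
  classical
  set M := 1 + τ ^ 2 with hM
  have hM1 : 1 ≤ M := by rw [hM]; nlinarith
  have hM0 : 0 ≤ M := by linarith
  have hs1 : r * M < 1 := by nlinarith [mul_nonneg hr.le hM0]
  have hn : ∀ b, ‖φ b‖ ≤ M := fun b => by simpa using hφ.norm_le b 1
  let ψ : B → ℂ := fun b => if b = 1 then 1 else r * φ b
  have hψ1 : ψ 1 = 1 := by simp [ψ]
  have hψKB : KB (fun g h => ψ (h⁻¹ * g)) M := by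
    have h2 := (hφ.smul (r:ℂ)).add (KB.eqKernel.smul (1 - r : ℂ))
    have h3 : (fun g h : B => ψ (h⁻¹ * g)) = fun g h => (r:ℂ) * φ (h⁻¹ * g) +
        (1 - r : ℂ) * (if g = h then 1 else 0) := by
      funext g h
      by_cases hgh : g = h
      · subst hgh; simp [ψ, h1]
      · have : h⁻¹ * g ≠ 1 := by rw [Ne, inv_mul_eq_one]; exact fun h => hgh h.symm
        simp [ψ, this, hgh]
    rw [h3]
    refine h2.mono ?_
    have h4 : ‖(1 - r : ℂ)‖ = 1 - r := by
      rw [← Complex.ofReal_one, ← Complex.ofReal_sub, Complex.norm_real, Real.norm_of_nonneg]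
      linarith
    rw [h4, Complex.norm_real, Real.norm_of_nonneg hr.le]
    nlinarith
  have hψs : ∀ b, b ≠ 1 → ‖ψ b‖ ≤ r * M := by
    intro b hb
    simp only [ψ, if_neg hb, norm_mul, Complex.norm_real, Real.norm_of_nonneg hr.le]
    exact mul_le_mul_of_nonneg_left (hn b) hr.le
  let f : ℕ → ℝ := fun N => r ^ N * (((N:ℝ) + 1) ^ 2 * (M ^ (2 * N) * (M + 2 + M ^ 2 + 1)))
  have hf : Summable f := by
    have hx : ‖r * M ^ 2‖ < 1 := by rw [Real.norm_of_nonneg (by positivity)]; exact hrM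
    have a2 := summable_pow_mul_geometric_of_norm_lt_one 2 hx
    have a1 := summable_pow_mul_geometric_of_norm_lt_one 1 hx
    have a0 := summable_pow_mul_geometric_of_norm_lt_one 0 hx
    have := ((a2.add (a1.mul_left 2)).add a0).mul_right (M + 2 + M ^ 2 + 1)
    refine this.congr (fun N => ?_)
    simp only [f]
    rw [mul_pow, pow_mul]
    ring
  have ht := tendsto_sum_nat_add f
  have hev := ht.eventually (gt_mem_nhds hη)
  obtain ⟨d0, hd0⟩ := eventually_atTop.1 hev
  refine ⟨d0, fun d hd I => ?_⟩
  have hd1 := hd0 (d + 1) (by omega)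
  have hK1 := KB_main (I := I) ψ hψ1 τ (r * M) h0 hτ hψKB (by positivity) hs1 hψs
  have hK2 : ∀ N : ℕ, KB (fun g h : CoprodI (fun _ : I => B) => (-((r:ℂ) ^ (N + d + 1))) *
      Ffun (fun n => if n = N + d + 1 then 1 else 0) φ (h⁻¹ * g)) (f (N + (d + 1))) := by
    intro N
    have := (KB_tail (I := I) φ h1 M hM1 hφ (N + d + 1) (fun n => if n = N + d + 1 then 1 else 0)
      (fun n => by split_ifs <;> simp) (fun n hn => if_neg (by omega))).smul (-((r:ℂ) ^ (N + d + 1)))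
    refine this.mono (le_of_eq ?_)
    rw [norm_neg, norm_pow, Complex.norm_real, Real.norm_of_nonneg hr.le]
    rfl
  have hK3 := KB.hasSum _ _ hK2 ((summable_nat_add_iff (d + 1)).2 hf).hasSum
    (fun g h => if (wd (h⁻¹ * g)).length ≤ d then 0 else
      - ((r:ℂ) ^ (wd (h⁻¹ * g)).length * Wt φ (wd (h⁻¹ * g)))) (fun g h => by
        simp only [Ffun, Fval]
        exact hasSum_tail d _ r _)
  have hK := (hK1.add hK3).mono (show _ ≤ 1 + 6 * τ / (1 - (r * M) ^ 2) + η by linarith)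
  convert hK using 3 with g h
  simp only [Ffun, Fval]
  rw [Wt_psi φ ψ r (fun b hb => if_neg hb) _ (red_wd _)]
  split_ifs <;> ring

lemma wa_normalize [Group B] (hB : WeaklyAmenableCH1 B) (S : Finset B) (ε : ℝ) (hε : 0 < ε) :
    ∃ φ : B → ℂ, (Function.support φ).Finite ∧ φ 1 = 1 ∧ KB (fun g h => φ (h⁻¹ * g)) (1 + ε) ∧
      ∀ g ∈ S, ‖φ g - 1‖ < ε := by
  classical
  set e : ℝ := min (ε / 5) (1 / 2) with he
  have he0 : 0 < e := by positivity
  have he1 : e ≤ 1 / 2 := min_le_right _ _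
  have he2 : 5 * e ≤ ε := by have := min_le_left (ε / 5) (1 / 2); linarith
  obtain ⟨φ, hfin, hcb, hS⟩ := hB (insert 1 S) e he0
  have h1 := hS 1 (by simp)
  have hn : 1 - e ≤ ‖φ 1‖ := by
    have := norm_sub_norm_le (1:ℂ) (1 - φ 1)
    rw [norm_sub_rev] at h1
    simp at this
    linarith
  have hn0 : 0 < ‖φ 1‖ := by linarith
  have hne : φ 1 ≠ 0 := norm_pos_iff.1 hn0
  refine ⟨fun b => (φ 1)⁻¹ * φ b, ?_, by simp [hne], ?_, ?_⟩
  · refine hfin.subset ?_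
    intro b hb
    simp only [Function.mem_support] at hb ⊢
    exact fun h => hb (by simp [h])
  · refine ((KB.of_cb hcb (by linarith)).smul (φ 1)⁻¹).mono ?_
    rw [norm_inv, inv_mul_le_iff₀ hn0]
    nlinarith
  · intro g hg
    have h2 := hS g (by simp [hg])
    have : (φ 1)⁻¹ * φ g - 1 = (φ 1)⁻¹ * ((φ g - 1) - (φ 1 - 1)) := by field_simp; ring
    rw [this, norm_mul, norm_inv, inv_mul_lt_iff₀ hn0]
    refine (norm_sub_le _ _).trans_lt ?_
    nlinarith

lemma FP [Group B] (hB : WeaklyAmenableCH1 B) (S : Finset B) (L : ℕ) (η : ℝ) (hη : 0 < η) :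
    ∃ (φ : B → ℂ) (p : ℕ → ℂ) (d : ℕ), (Function.support φ).Finite ∧ (∀ n, d < n → p n = 0) ∧
      (∀ b ∈ S, ‖φ b - 1‖ < η) ∧ (∀ n ≤ L, ‖p n - 1‖ < η) ∧
      ∀ I : Type, KB (fun g h : CoprodI (fun _ : I => B) => Ffun p φ (h⁻¹ * g)) (1 + η) := by
  obtain ⟨r, hr, hr1, hrL⟩ : ∃ r : ℝ, 0 < r ∧ r < 1 ∧ ∀ n ≤ L, 1 - η < r ^ n := by
    set e : ℝ := min η 1 / 2 / (L + 1) with he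
    have h1 : min η 1 ≤ 1 := min_le_right _ _
    have h1' : min η 1 ≤ η := min_le_left _ _
    have h2 : 0 < min η 1 := by positivity
    have he0 : 0 < e := by positivity
    have heL : e * (L + 1) = min η 1 / 2 := by rw [he]; field_simp
    have hL : (0:ℝ) ≤ L := Nat.cast_nonneg _
    have he1 : e ≤ 1 / 2 := by nlinarith
    refine ⟨1 + -e, by linarith, by linarith, fun n hn => ?_⟩
    have h3 := one_add_mul_le_pow (show -2 ≤ -e by linarith) n
    have h4 : (n:ℝ) ≤ L := by exact_mod_cast hn
    nlinarith
  obtain ⟨τ, h0, hτ, hrM, hest⟩ : ∃ τ : ℝ, 0 < τ ∧ τ ≤ 1 ∧ r * (1 + τ ^ 2) ^ 2 < 1 ∧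
      6 * τ / (1 - (r * (1 + τ ^ 2)) ^ 2) < η / 2 ∧ τ ^ 2 ≤ η := by
    have c1 : Tendsto (fun τ : ℝ => r * (1 + τ ^ 2) ^ 2) (𝓝 0) (𝓝 (r * (1 + 0 ^ 2) ^ 2)) :=
      (by fun_prop : Continuous (fun τ : ℝ => r * (1 + τ ^ 2) ^ 2)).tendsto 0
    have c2 : Tendsto (fun τ : ℝ => 6 * τ / (1 - (r * (1 + τ ^ 2)) ^ 2)) (𝓝 0)
        (𝓝 (6 * 0 / (1 - (r * (1 + 0 ^ 2)) ^ 2))) := by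
      refine Tendsto.div ?_ ?_ ?_
      · exact (by fun_prop : Continuous (fun τ : ℝ => 6 * τ)).tendsto 0
      · exact (by fun_prop : Continuous (fun τ : ℝ => 1 - (r * (1 + τ ^ 2)) ^ 2)).tendsto 0
      · norm_num; nlinarith
    have c3 : Tendsto (fun τ : ℝ => τ ^ 2) (𝓝 0) (𝓝 (0 ^ 2)) :=
      (by fun_prop : Continuous (fun τ : ℝ => τ ^ 2)).tendsto 0
    have e1 := (c1.eventually (gt_mem_nhds (show r * (1 + 0 ^ 2) ^ 2 < 1 by norm_num; exact hr1)))
    have e2 := (c2.eventually (gt_mem_nhds (show 6 * 0 / (1 - (r * (1 + 0 ^ 2)) ^ 2) < η / 2 by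
      norm_num; exact hη)))
    have e3 := (c3.eventually (gt_mem_nhds (show (0:ℝ) ^ 2 < η by norm_num; exact hη)))
    have e4 : ∀ᶠ τ : ℝ in 𝓝 0, τ < 1 := gt_mem_nhds one_pos
    have e5 := ((e1.and (e2.and (e3.and e4))).filter_mono
      (nhdsWithin_le_nhds (s := Set.Ioi 0))).and self_mem_nhdsWithin
    obtain ⟨τ, ⟨f1, f2, f3, f4⟩, f5⟩ := e5.exists
    exact ⟨τ, f5, f4.le, f1, f2, f3.le⟩
  obtain ⟨φ, hfin, h1, hKB, hS⟩ := wa_normalize hB S (τ ^ 2) (by positivity)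
  obtain ⟨d0, hd0⟩ := KB_cut φ h1 τ r h0.le hτ hKB hr hr1 hrM (η / 2) (by positivity)
  refine ⟨φ, fun n => if n ≤ max d0 L then (r:ℂ) ^ n else 0, max d0 L, hfin, ?_, ?_, ?_, ?_⟩
  · intro n hn; exact if_neg (by omega)
  · intro b hb; exact (hS b hb).trans_le hest.2
  · intro n hn
    simp only [if_pos (show n ≤ max d0 L by omega)]
    rw [← Complex.ofReal_pow, ← Complex.ofReal_one, ← Complex.ofReal_sub, Complex.norm_real,
      Real.norm_eq_abs, abs_lt]
    have := hrL n hn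
    have h2 : r ^ n ≤ 1 := pow_le_one₀ hr.le hr1.le
    constructor <;> linarith
  · intro I
    exact (hd0 (max d0 L) (le_max_left _ _) I).mono (by linarith [hest.1])
end Cutoff

section Shift
open Monoid
variable {I B : Type} [Group B]

/-- permuting the free factors -/
def Tm (e : I → I) : CoprodI (fun _ : I => B) →* CoprodI (fun _ : I => B) :=
  CoprodI.lift (fun i => CoprodI.of (M := fun _ : I => B) (i := e i))

lemma Tm_of (e : I → I) (i : I) (b : B) : Tm e (CoprodI.of (M := fun _ : I => B) (i := i) b) =
    CoprodI.of (M := fun _ : I => B) (i := e i) b := by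
  simp [Tm]

lemma Tm_comp (e f : I → I) (x : CoprodI (fun _ : I => B)) : Tm e (Tm f x) = Tm (e ∘ f) x := by
  rw [← MonoidHom.comp_apply]
  congr 1
  apply CoprodI.ext_hom
  intro i
  ext b
  simp [Tm_of]

lemma Tm_id (x : CoprodI (fun _ : I => B)) : Tm id x = x := by
  have : (Tm id : CoprodI (fun _ : I => B) →* _) = MonoidHom.id _ := by
    apply CoprodI.ext_hom
    intro i
    ext b
    simp [Tm_of]
  rw [this]; rfl

/-- shifting lists -/
def sh (e : I → I) (l : List (Σ _ : I, B)) : List (Σ _ : I, B) := l.map (fun s => ⟨e s.1, s.2⟩)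

lemma lprod_sh (e : I → I) (l : List (Σ _ : I, B)) : lprod (sh e l) = Tm e (lprod l) := by
  induction l with
  | nil => simp [lprod, sh]
  | cons s t ih =>
    rw [lprod_cons, map_mul, ← ih, Tm_of]
    simp [sh, lprod]

lemma red_sh (e : I → I) (he : Function.Injective e) (l : List (Σ _ : I, B)) (h : Red l) :
    Red (sh e l) := by
  refine ⟨?_, ?_⟩
  · intro s hs
    simp only [sh, List.mem_map] at hs
    obtain ⟨a, ha, rfl⟩ := hs
    exact h.1 a ha
  · rw [sh, List.isChain_map]
    exact h.2.imp (fun a b hab => fun h => hab (he h))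

lemma Ffun_Tm (p : ℕ → ℂ) (φ : B → ℂ) (e : I → I) (he : Function.Injective e)
    (g : CoprodI (fun _ : I => B)) : Ffun p φ (Tm e g) = Ffun p φ g := by
  conv_lhs => rw [← lprod_wd g, ← lprod_sh, Ffun, wd_lprod (red_sh e he _ (red_wd g))]
  simp [Ffun, Fval, sh, Wt, Function.comp_def]

/-- the action -/
def sig (K : Type) [Group K] [MulAction K I] : K →* MulAut (CoprodI (fun _ : I => B)) where
  toFun a :=
    { toFun := Tm (fun i => a • i)
      invFun := Tm (fun i => a⁻¹ • i)
      left_inv := fun x => by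
        rw [Tm_comp]
        convert Tm_id x using 2
        congr 1; funext i; simp
      right_inv := fun x => by
        rw [Tm_comp]
        convert Tm_id x using 2
        congr 1; funext i; simp
      map_mul' := map_mul _ }
  map_one' := by
    ext x
    change Tm (fun i => (1:K) • i) x = x
    convert Tm_id x using 2
    congr 1; funext i; simp
  map_mul' a b := by
    ext x
    change Tm (fun i => (a * b) • i) x = Tm _ (Tm _ x)
    rw [Tm_comp]
    congr 2; funext i; simp [mul_smul]

lemma sig_apply (K : Type) [Group K] [MulAction K I] (a : K) (x : CoprodI (fun _ : I => B)) :
    sig K a x = Tm (fun i => a • i) x := rfl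
end Shift

section GP
open Monoid
variable {V : Type} (Γ : SimpleGraph V) (G : V → Type) [∀ v, Group (G v)]

/-- vertex inclusion -/
def gpHom (u : V) : G u →* GraphProduct Γ G :=
  (QuotientGroup.mk' (Subgroup.normalClosure (commRels Γ G))).comp CoprodI.of

lemma gpHom_apply (u : V) (x : G u) : gpHom Γ G u x = ofSyl Γ G ⟨u, x⟩ := rfl

lemma gp_comm (u v : V) (h : Γ.Adj u v) (x : G u) (y : G v) :
    ofSyl Γ G ⟨u, x⟩ * ofSyl Γ G ⟨v, y⟩ = ofSyl Γ G ⟨v, y⟩ * ofSyl Γ G ⟨u, x⟩ := by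
  have : (QuotientGroup.mk' (Subgroup.normalClosure (commRels Γ G)))
      ⁅CoprodI.of x, CoprodI.of y⁆ = 1 :=
    (QuotientGroup.eq_one_iff _).2 (Subgroup.subset_normalClosure ⟨u, v, x, y, h, rfl⟩)
  rw [map_commutatorElement, commutatorElement_eq_one_iff_mul_comm] at this
  exact this

/-- universal property -/
def gpLift {K : Type} [Group K] (f : ∀ u, G u →* K)
    (h : ∀ u v, Γ.Adj u v → ∀ (x : G u) (y : G v), f u x * f v y = f v y * f u x) :
    GraphProduct Γ G →* K :=
  QuotientGroup.lift _ (CoprodI.lift f) (fun a ha => by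
    have : Subgroup.normalClosure (commRels Γ G) ≤ (CoprodI.lift f).ker := by
      apply Subgroup.normalClosure_le_normal
      rintro _ ⟨u, v, x, y, huv, rfl⟩
      change CoprodI.lift f _ = 1
      rw [map_commutatorElement, commutatorElement_eq_one_iff_mul_comm]
      simpa using h u v huv x y
    exact this ha)

lemma gpLift_ofSyl {K : Type} [Group K] (f : ∀ u, G u →* K)
    (h : ∀ u v, Γ.Adj u v → ∀ (x : G u) (y : G v), f u x * f v y = f v y * f u x)
    (s : Σ u, G u) : gpLift Γ G f h (ofSyl Γ G s) = f s.1 s.2 := by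
  change CoprodI.lift f (CoprodI.of s.2) = _
  simp

lemma wordProd_cons (s : Σ u, G u) (w : List (Σ u, G u)) :
    wordProd Γ G (s :: w) = ofSyl Γ G s * wordProd Γ G w := by simp [wordProd]

lemma wordProd_append (w w' : List (Σ u, G u)) :
    wordProd Γ G (w ++ w') = wordProd Γ G w * wordProd Γ G w' := by simp [wordProd]

lemma wordProd_surj (g : GraphProduct Γ G) : ∃ w, wordProd Γ G w = g := by
  obtain ⟨x, rfl⟩ := QuotientGroup.mk_surjective g
  induction x using CoprodI.induction_on with
  | one => exact ⟨[], rfl⟩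
  | of i m => exact ⟨[⟨i, m⟩], by simp [wordProd, ofSyl]⟩
  | mul x y hx hy =>
    obtain ⟨w, hw⟩ := hx
    obtain ⟨w', hw'⟩ := hy
    exact ⟨w ++ w', by rw [wordProd_append, hw, hw']; rfl⟩

/-- star subgroup -/
def starS (v : V) : Subgroup (GraphProduct Γ G) :=
  Subgroup.closure {g | ∃ s : Σ u, G u, (s.1 = v ∨ Γ.Adj v s.1) ∧ g = ofSyl Γ G s}

lemma mem_starS (v : V) (s : Σ u, G u) (h : s.1 = v ∨ Γ.Adj v s.1) :
    ofSyl Γ G s ∈ starS Γ G v := Subgroup.subset_closure ⟨s, h, rfl⟩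

/-- index set -/
abbrev Ix (v : V) := GraphProduct Γ G ⧸ starS Γ G v

/-- base point -/
def bp (v : V) : Ix Γ G v := QuotientGroup.mk 1

lemma smul_bp (v : V) (g : GraphProduct Γ G) : g • bp Γ G v = QuotientGroup.mk g := by
  change QuotientGroup.mk (g * 1) = _
  rw [mul_one]

lemma smul_bp_star (v : V) (s : Σ u, G u) (h : s.1 = v ∨ Γ.Adj v s.1) :
    ofSyl Γ G s • bp Γ G v = bp Γ G v := by
  rw [smul_bp]
  apply QuotientGroup.eq.2
  simpa using mem_starS Γ G v s h

/-- target -/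
abbrev SD (v : V) := SemidirectProduct (CoprodI (fun _ : Ix Γ G v => G v)) (GraphProduct Γ G)
  (sig (I := Ix Γ G v) (B := G v) (GraphProduct Γ G))

open Classical in
/-- left part -/
noncomputable def lft (v : V) : ∀ u, G u →* CoprodI (fun _ : Ix Γ G v => G v) :=
  Function.update (β := fun u => G u →* CoprodI (fun _ : Ix Γ G v => G v)) (fun _ => 1) v
    (CoprodI.of (M := fun _ : Ix Γ G v => G v) (i := bp Γ G v))

lemma lft_self (v : V) (x : G v) : lft Γ G v v x =
    CoprodI.of (M := fun _ : Ix Γ G v => G v) (i := bp Γ G v) x := by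
  simp [lft]

lemma lft_ne (v u : V) (h : u ≠ v) (x : G u) : lft Γ G v u x = 1 := by
  classical
  simp [lft, Function.update_of_ne h]

lemma sig_lft (v u : V) (s : Σ u, G u) (h : s.1 = v ∨ Γ.Adj v s.1) (y : G u) :
    sig (I := Ix Γ G v) (B := G v) (GraphProduct Γ G) (ofSyl Γ G s) (lft Γ G v u y) =
      lft Γ G v u y := by
  by_cases hu : u = v
  · subst hu
    rw [lft_self, sig_apply, Tm_of, smul_bp_star Γ G u s h]
  · rw [lft_ne Γ G v u hu, map_one]

/-- piece -/
noncomputable def piSyl (v u : V) : G u →* SD Γ G v where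
  toFun x := ⟨lft Γ G v u x, gpHom Γ G u x⟩
  map_one' := by rw [map_one, map_one]; rfl
  map_mul' x y := by
    apply SemidirectProduct.ext
    · rw [SemidirectProduct.mul_left, map_mul]
      simp only [gpHom_apply]
      by_cases hu : u = v
      · rw [sig_lft Γ G v u ⟨u, x⟩ (Or.inl hu)]
      · simp [lft_ne Γ G v u hu]
    · rw [SemidirectProduct.mul_right]
      exact map_mul _ _ _

lemma piSyl_comm (v u u' : V) (h : Γ.Adj u u') (x : G u) (y : G u') :
    piSyl Γ G v u x * piSyl Γ G v u' y = piSyl Γ G v u' y * piSyl Γ G v u x := by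
  apply SemidirectProduct.ext
  · rw [SemidirectProduct.mul_left, SemidirectProduct.mul_left]
    simp only [piSyl, MonoidHom.coe_mk, OneHom.coe_mk, gpHom_apply]
    by_cases hu : u = v
    · have hu' : u' ≠ v := fun h' => h.ne (hu.trans h'.symm)
      rw [sig_lft Γ G v u ⟨u', y⟩ (Or.inr (hu ▸ h)), lft_ne Γ G v u' hu']
      simp
    · by_cases hu' : u' = v
      · rw [sig_lft Γ G v u' ⟨u, x⟩ (Or.inr (hu' ▸ h.symm)), lft_ne Γ G v u hu]
        simp
      · simp [lft_ne Γ G v u hu, lft_ne Γ G v u' hu']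
  · rw [SemidirectProduct.mul_right, SemidirectProduct.mul_right]
    exact gp_comm Γ G u u' h x y

/-- the map -/
noncomputable def piM (v : V) : GraphProduct Γ G →* SD Γ G v :=
  gpLift Γ G (piSyl Γ G v) (piSyl_comm Γ G v)

lemma piM_ofSyl (v : V) (s : Σ u, G u) : piM Γ G v (ofSyl Γ G s) =
    ⟨lft Γ G v s.1 s.2, ofSyl Γ G s⟩ := by
  rw [piM, gpLift_ofSyl]
  rfl

lemma piM_right (v : V) (g : GraphProduct Γ G) : (piM Γ G v g).right = g := by
  obtain ⟨w, rfl⟩ := wordProd_surj Γ G g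
  induction w with
  | nil => simp [wordProd]
  | cons s w ih => rw [wordProd_cons, map_mul, SemidirectProduct.mul_right, ih, piM_ofSyl]

/-- cocycle -/
noncomputable def coc (v : V) (g : GraphProduct Γ G) : CoprodI (fun _ : Ix Γ G v => G v) :=
  (piM Γ G v g).left

lemma coc_mul (v : V) (g h : GraphProduct Γ G) :
    coc Γ G v (g * h) = coc Γ G v g * Tm (fun i => g • i) (coc Γ G v h) := by
  rw [coc, map_mul, SemidirectProduct.mul_left, piM_right]
  rfl

lemma coc_one (v : V) : coc Γ G v 1 = 1 := by simp [coc]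

lemma coc_ofSyl (v : V) (s : Σ u, G u) : coc Γ G v (ofSyl Γ G s) = lft Γ G v s.1 s.2 := by
  rw [coc, piM_ofSyl]

lemma Ffun_coc (v : V) (p : ℕ → ℂ) (φ : G v → ℂ) (g h : GraphProduct Γ G) :
    Ffun p φ (coc Γ G v (h⁻¹ * g)) = Ffun p φ ((coc Γ G v h)⁻¹ * coc Γ G v g) := by
  have h1 : coc Γ G v h * Tm (fun i => h • i) (coc Γ G v (h⁻¹ * g)) = coc Γ G v g := by
    rw [← coc_mul, mul_inv_cancel_left]
  rw [← h1, inv_mul_cancel_left, Ffun_Tm]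
  exact MulAction.injective h

lemma KB_coc (v : V) (p : ℕ → ℂ) (φ : G v → ℂ) (C : ℝ)
    (hK : KB (fun g h : CoprodI (fun _ : Ix Γ G v => G v) => Ffun p φ (h⁻¹ * g)) C) :
    KB (fun g h : GraphProduct Γ G => Ffun p φ (coc Γ G v (h⁻¹ * g))) C := by
  simp only [Ffun_coc]
  exact hK.pullback (coc Γ G v)
end GP

section Words
open Monoid
variable {V : Type} (Γ : SimpleGraph V) (G : V → Type) [∀ v, Group (G v)]

open Classical in
/-- the list of `v`-letters with their cosets -/
noncomputable def RL (v : V) : List (Σ u, G u) → List (Σ _ : Ix Γ G v, G v)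
  | [] => []
  | s :: w => if h : s.1 = v then ⟨bp Γ G v, h ▸ s.2⟩ :: sh (fun i => ofSyl Γ G s • i) (RL v w)
      else sh (fun i => ofSyl Γ G s • i) (RL v w)

lemma RL_self (v : V) (x : G v) (w : List (Σ u, G u)) : RL Γ G v (⟨v, x⟩ :: w) =
    ⟨bp Γ G v, x⟩ :: sh (fun i => ofSyl Γ G ⟨v, x⟩ • i) (RL Γ G v w) := by
  simp [RL]

lemma RL_ne (v : V) (s : Σ u, G u) (hs : s.1 ≠ v) (w : List (Σ u, G u)) : RL Γ G v (s :: w) =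
    sh (fun i => ofSyl Γ G s • i) (RL Γ G v w) := by
  simp [RL, hs]

lemma lprod_RL (v : V) (w : List (Σ u, G u)) :
    lprod (RL Γ G v w) = coc Γ G v (wordProd Γ G w) := by
  induction w with
  | nil => simp [RL, lprod, wordProd, coc_one]
  | cons s w ih =>
    rw [wordProd_cons, coc_mul, coc_ofSyl, ← ih, ← lprod_sh]
    obtain ⟨u, x⟩ := s
    by_cases hu : u = v
    · subst hu
      rw [RL_self, lprod_cons, lft_self]
    · rw [RL_ne Γ G v _ hu, lft_ne Γ G v u hu, one_mul]

lemma RL_head (v : V) (w : List (Σ u, G u)) (c : Ix Γ G v) (b : G v)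
    (rest : List (Σ _ : Ix Γ G v, G v)) (h : RL Γ G v w = ⟨c, b⟩ :: rest) :
    ∃ pre post, w = pre ++ ⟨v, b⟩ :: post ∧ (∀ s ∈ pre, s.1 ≠ v) ∧
      c = QuotientGroup.mk (wordProd Γ G pre) := by
  induction w generalizing c rest with
  | nil => simp [RL] at h
  | cons s w ih =>
    obtain ⟨u, x⟩ := s
    by_cases hu : u = v
    · subst hu
      rw [RL_self] at h
      simp only [List.cons.injEq, Sigma.mk.injEq, heq_eq_eq] at h
      obtain ⟨⟨rfl, rfl⟩, -⟩ := h
      exact ⟨[], w, rfl, by simp, rfl⟩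
    · rw [RL_ne Γ G v _ hu] at h
      rcases hR : RL Γ G v w with _ | ⟨⟨c', b'⟩, rest'⟩
      · simp [hR, sh] at h
      · rw [hR] at h
        simp only [sh, List.map_cons, List.cons.injEq, Sigma.mk.injEq, heq_eq_eq] at h
        obtain ⟨⟨rfl, rfl⟩, -⟩ := h
        obtain ⟨pre, post, h1, h2, h3⟩ := ih c' rest' hR
        refine ⟨⟨u, x⟩ :: pre, post, by simp [h1], ?_, ?_⟩
        · intro s hs
          rcases List.mem_cons.1 hs with rfl | hs
          · exact hu
          · exact h2 s hs
        · rw [h3, wordProd_cons]; rfl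

/-- minimal words -/
def MinW (w : List (Σ u, G u)) : Prop :=
  ∀ w', wordProd Γ G w' = wordProd Γ G w → w.length ≤ w'.length

lemma MinW.right {a b : List (Σ u, G u)} (h : MinW Γ G (a ++ b)) : MinW Γ G b := by
  intro w' hw'
  have := h (a ++ w') (by rw [wordProd_append, wordProd_append, hw'])
  simpa using this

lemma MinW.left {a b : List (Σ u, G u)} (h : MinW Γ G (a ++ b)) : MinW Γ G a := by
  intro w' hw'
  have := h (w' ++ b) (by rw [wordProd_append, wordProd_append, hw'])
  simpa using this

lemma exists_min (g : GraphProduct Γ G) : ∃ w, wordProd Γ G w = g ∧ MinW Γ G w := by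
  classical
  obtain ⟨w0, hw0⟩ := wordProd_surj Γ G g
  have hex : ∃ n, ∃ w, wordProd Γ G w = g ∧ w.length = n := ⟨_, w0, hw0, rfl⟩
  obtain ⟨w, hw, hn⟩ := Nat.find_spec hex
  exact ⟨w, hw, fun w' h' => hn ▸ Nat.find_min' hex ⟨w', h'.trans hw, rfl⟩⟩

open Classical in
/-- retraction to the star subgroup -/
noncomputable def retr (v : V) : GraphProduct Γ G →* GraphProduct Γ G :=
  gpLift Γ G (fun u => if u = v ∨ Γ.Adj v u then gpHom Γ G u else 1) (by
    intro a b hab x y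
    split_ifs
    · exact gp_comm Γ G a b hab x y
    · simp
    · simp
    · simp)

open Classical in
lemma retr_ofSyl (v : V) (s : Σ u, G u) : retr Γ G v (ofSyl Γ G s) =
    if s.1 = v ∨ Γ.Adj v s.1 then ofSyl Γ G s else 1 := by
  rw [retr, gpLift_ofSyl]
  split_ifs <;> rfl

open Classical in
lemma retr_word (v : V) (w : List (Σ u, G u)) : retr Γ G v (wordProd Γ G w) =
    wordProd Γ G (w.filter (fun s => s.1 = v ∨ Γ.Adj v s.1)) := by
  induction w with
  | nil => simp [wordProd]
  | cons s w ih =>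
    rw [wordProd_cons, map_mul, ih, retr_ofSyl]
    by_cases h : s.1 = v ∨ Γ.Adj v s.1
    · rw [if_pos h, List.filter_cons_of_pos (by simpa using h), wordProd_cons]
    · rw [if_neg h, List.filter_cons_of_neg (by simpa using h), one_mul]

lemma retr_star (v : V) (g : GraphProduct Γ G) (hg : g ∈ starS Γ G v) : retr Γ G v g = g := by
  have : starS Γ G v ≤ MonoidHom.eqLocus (retr Γ G v) (MonoidHom.id _) := by
    rw [starS, Subgroup.closure_le]
    rintro _ ⟨s, hs, rfl⟩
    change retr Γ G v (ofSyl Γ G s) = ofSyl Γ G s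
    rw [retr_ofSyl, if_pos hs]
  exact this hg

lemma min_star (v : V) (w : List (Σ u, G u)) (hw : MinW Γ G w)
    (h : wordProd Γ G w ∈ starS Γ G v) : ∀ s ∈ w, s.1 = v ∨ Γ.Adj v s.1 := by
  classical
  have h1 := retr_star Γ G v _ h
  rw [retr_word] at h1
  have h2 := hw _ h1
  have h3 : w.filter (fun s => s.1 = v ∨ Γ.Adj v s.1) = w :=
    List.filter_sublist.eq_of_length_le h2
  intro s hs
  rw [← h3] at hs
  simpa using (List.mem_filter.1 hs).2

lemma word_comm (v : V) (x : G v) (w : List (Σ u, G u)) (h : ∀ s ∈ w, Γ.Adj v s.1) :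
    ofSyl Γ G ⟨v, x⟩ * wordProd Γ G w = wordProd Γ G w * ofSyl Γ G ⟨v, x⟩ := by
  induction w with
  | nil => simp [wordProd]
  | cons s w ih =>
    rw [wordProd_cons, ← mul_assoc, gp_comm Γ G v s.1 (h s (by simp)) x s.2, mul_assoc,
      ih (fun s hs => h s (by simp [hs])), mul_assoc]

lemma red_RL (v : V) (w : List (Σ u, G u)) (hw : MinW Γ G w) : Red (RL Γ G v w) := by
  induction w with
  | nil => exact ⟨by simp [RL], by simp [RL]⟩
  | cons s w ih =>
    have hw1 : MinW Γ G w := MinW.right Γ G (a := [s]) hw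
    have h1 := red_sh (fun i => ofSyl Γ G s • i) (MulAction.injective _) _ (ih hw1)
    obtain ⟨u, x⟩ := s
    by_cases hu : u = v
    · subst hu
      rw [RL_self]
      refine ⟨?_, ?_⟩
      · intro s hs
        rcases List.mem_cons.1 hs with rfl | hs
        · rintro h
          simp only at h
          subst h
          have := hw w (by rw [wordProd_cons, ← gpHom_apply, map_one, one_mul])
          simp at this
        · exact h1.1 s hs
      · rw [List.isChain_cons]
        refine ⟨?_, h1.2⟩
        rcases hR : RL Γ G u w with _ | ⟨⟨c, b⟩, rest⟩
        · simp [sh]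
        · simp only [sh, List.map_cons, List.head?_cons, Option.mem_some_iff]
          rintro _ rfl heq
          obtain ⟨pre, post, e1, e2, e3⟩ := RL_head Γ G u w c b rest hR
          simp only at heq
          have hmem : wordProd Γ G pre ∈ starS Γ G u := by
            rw [e3] at heq
            have h2 : (QuotientGroup.mk 1 : Ix Γ G u) =
              QuotientGroup.mk (ofSyl Γ G ⟨u, x⟩ * wordProd Γ G pre) := heq
            have h3 := QuotientGroup.eq.1 h2
            rw [inv_one, one_mul] at h3
            exact (Subgroup.mul_mem_cancel_left _ (mem_starS Γ G u ⟨u, x⟩ (Or.inl rfl))).1 h3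
          subst e1
          have hadj : ∀ s ∈ pre, Γ.Adj u s.1 := fun s hs =>
            (min_star Γ G u pre (MinW.left Γ G hw1) hmem s hs).resolve_left (e2 s hs)
          have := hw (pre ++ ⟨u, x * b⟩ :: post) (by
            rw [wordProd_cons, wordProd_append, wordProd_append, wordProd_cons, wordProd_cons,
              ← mul_assoc (ofSyl Γ G ⟨u, x⟩), word_comm Γ G u x pre hadj, ← gpHom_apply, map_mul]
            simp only [gpHom_apply, mul_assoc])
          simp at this
    · rw [RL_ne Γ G v _ hu]
      exact h1

lemma wd_coc (v : V) (w : List (Σ u, G u)) (hw : MinW Γ G w) :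
    wd (coc Γ G v (wordProd Γ G w)) = RL Γ G v w := by
  rw [← lprod_RL, wd_lprod (red_RL Γ G v w hw)]

lemma mem_RL (v : V) (x : G v) (w : List (Σ u, G u)) (h : (⟨v, x⟩ : Σ u, G u) ∈ w) :
    ∃ c, (⟨c, x⟩ : Σ _ : Ix Γ G v, G v) ∈ RL Γ G v w := by
  induction w with
  | nil => simp at h
  | cons s w ih =>
    rcases List.mem_cons.1 h with rfl | h
    · exact ⟨bp Γ G v, by rw [RL_self]; simp⟩
    · obtain ⟨c, hc⟩ := ih h
      refine ⟨ofSyl Γ G s • c, ?_⟩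
      have : (⟨ofSyl Γ G s • c, x⟩ : Σ _ : Ix Γ G v, G v) ∈
          sh (fun i => ofSyl Γ G s • i) (RL Γ G v w) := List.mem_map.2 ⟨_, hc, rfl⟩
      obtain ⟨u, y⟩ := s
      by_cases hu : u = v
      · subst hu
        rw [RL_self]
        exact List.mem_cons_of_mem _ this
      · rw [RL_ne Γ G v _ hu]
        exact this

lemma length_RL [Fintype V] (w : List (Σ u, G u)) : w.length = ∑ v, (RL Γ G v w).length := by
  classical
  induction w with
  | nil => simp [RL]
  | cons s w ih =>
    obtain ⟨u, x⟩ := s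
    have : ∀ v, (RL Γ G v (⟨u, x⟩ :: w)).length = (RL Γ G v w).length + if u = v then 1 else 0 := by
      intro v
      by_cases hu : u = v
      · subst hu
        rw [RL_self]; simp [sh]
      · rw [RL_ne Γ G v _ hu]; simp [sh, hu]
    simp [this, Finset.sum_add_distrib, ih]

lemma lists_finite {X : Type} (F : Set X) (hF : F.Finite) (n : ℕ) :
    {l : List X | l.length ≤ n ∧ ∀ x ∈ l, x ∈ F}.Finite := by
  have := hF.to_subtype
  refine ((List.finite_length_le F n).image (List.map Subtype.val)).subset ?_
  rintro l ⟨h1, h2⟩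
  refine ⟨l.attach.map (fun x => ⟨x.1, h2 _ x.2⟩), by simpa using h1, ?_⟩
  simp [Function.comp_def]

lemma fin_supp [Fintype V] (φ : ∀ v, G v → ℂ) (p : V → ℕ → ℂ) (d : V → ℕ)
    (hφ : ∀ v, (Function.support (φ v)).Finite) (hp : ∀ v n, d v < n → p v n = 0) :
    (Function.support (fun g : GraphProduct Γ G =>
      ∏ v, Ffun (p v) (φ v) (coc Γ G v g))).Finite := by
  have hF : (⋃ v, (Sigma.mk v) '' (Function.support (φ v)) : Set (Σ v, G v)).Finite :=
    Set.finite_iUnion (fun v => (hφ v).image _)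
  refine ((lists_finite _ hF (∑ v, d v)).image (wordProd Γ G)).subset ?_
  intro g hg
  obtain ⟨w, rfl, hw⟩ := exists_min Γ G g
  refine ⟨w, ⟨?_, ?_⟩, rfl⟩
  · rw [length_RL Γ G w]
    apply Finset.sum_le_sum
    intro v _
    by_contra hlt
    apply hg
    refine Finset.prod_eq_zero (Finset.mem_univ v) ?_
    rw [Ffun, Fval, wd_coc Γ G v w hw, hp v _ (by omega), zero_mul]
  · rintro ⟨v, x⟩ hx
    refine Set.mem_iUnion.2 ⟨v, x, ?_, rfl⟩
    intro h0
    apply hg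
    refine Finset.prod_eq_zero (Finset.mem_univ v) ?_
    obtain ⟨c, hc⟩ := mem_RL Γ G v x w hx
    rw [Ffun, Fval, wd_coc Γ G v w hw, Wt, List.prod_eq_zero, mul_zero]
    exact List.mem_map.2 ⟨_, hc, h0⟩
end Words

section Final
open Monoid Filter Topology

lemma list_prod_tendsto {X : Type} (φ : ℕ → X → ℂ) (l : List X)
    (h : ∀ x ∈ l, Tendsto (fun k => φ k x) atTop (𝓝 1)) :
    Tendsto (fun k => (l.map (φ k)).prod) atTop (𝓝 1) := by
  induction l with
  | nil => simp
  | cons x l ih =>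
    have := (h x (by simp)).mul (ih (fun y hy => h y (by simp [hy])))
    simpa using this

lemma tendsto_aux (f : ℕ → ℂ) (h : ∀ᶠ k in atTop, ‖f k - 1‖ < 1 / ((k:ℝ) + 1)) :
    Tendsto f atTop (𝓝 1) := by
  rw [tendsto_iff_norm_sub_tendsto_zero]
  exact squeeze_zero' (Eventually.of_forall fun _ => norm_nonneg _)
    (h.mono fun _ h => h.le) tendsto_one_div_add_atTop_nhds_zero_nat

theorem main_gp {V : Type} [Fintype V] (Γ : SimpleGraph V) (G : V → Type) [∀ v, Group (G v)]
    (h : ∀ v, WeaklyAmenableCH1 (G v)) : WeaklyAmenableCH1 (GraphProduct Γ G) := by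
  classical
  intro S ε hε
  let S0 : ∀ v, Finset (G v) := fun v =>
    S.biUnion (fun g => ((wd (coc Γ G v g)).map (fun s => s.2)).toFinset)
  choose φ p d hφ hp hS hL hK using fun (k : ℕ) (v : V) =>
    FP (h v) (S0 v) k (1 / ((k:ℝ) + 1)) (by positivity)
  let F : ℕ → GraphProduct Γ G → ℂ := fun k g => ∏ v, Ffun (p k v) (φ k v) (coc Γ G v g)
  have hlim : ∀ g ∈ S, Tendsto (fun k => F k g) atTop (𝓝 1) := by
    intro g hg
    have : Tendsto (fun k => F k g) atTop (𝓝 (∏ _v : V, (1:ℂ))) := by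
      apply tendsto_finsetProd
      intro v _
      have a1 : Tendsto (fun k => p k v (wd (coc Γ G v g)).length) atTop (𝓝 1) := by
        apply tendsto_aux
        filter_upwards [eventually_ge_atTop (wd (coc Γ G v g)).length] with k hk
        exact hL k v _ hk
      have a2 := list_prod_tendsto (fun k (s : Σ _ : Ix Γ G v, G v) => φ k v s.2)
        (wd (coc Γ G v g)) (by
          intro s hs
          apply tendsto_aux
          refine Eventually.of_forall fun k => hS k v _ ?_
          simp only [S0, Finset.mem_biUnion, List.mem_toFinset, List.mem_map]
          exact ⟨g, hg, s, hs, rfl⟩)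
      have a3 := a1.mul a2
      rw [one_mul] at a3
      exact a3
    simpa using this
  have hbd : Tendsto (fun k : ℕ => ∏ _v : V, (1 + 1 / ((k:ℝ) + 1))) atTop (𝓝 1) := by
    have : Tendsto (fun k : ℕ => ∏ _v : V, (1 + 1 / ((k:ℝ) + 1))) atTop
        (𝓝 (∏ _v : V, (1 + 0 : ℝ))) := by
      apply tendsto_finsetProd
      intro v _
      exact tendsto_const_nhds.add tendsto_one_div_add_atTop_nhds_zero_nat
    simpa using this
  have e1 : ∀ᶠ k in atTop, ∀ g ∈ S, ‖F k g - 1‖ < ε := by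
    rw [Filter.eventually_all_finset]
    intro g hg
    have := (hlim g hg).eventually (Metric.ball_mem_nhds 1 hε)
    simpa [dist_eq_norm] using this
  have e2 := hbd.eventually (gt_mem_nhds (show (1:ℝ) < 1 + ε by linarith))
  obtain ⟨k, hk1, hk2⟩ := (e1.and e2).exists
  refine ⟨F k, fin_supp Γ G (φ k) (p k) (d k) (hφ k) (hp k), ?_, hk1⟩
  apply KB.to_cb
  refine KB.mono ?_ hk2.le
  exact KB.finprod Finset.univ (fun v g h => Ffun (p k v) (φ k v) (coc Γ G v (h⁻¹ * g)))
    (fun _ => 1 + 1 / ((k:ℝ) + 1)) (fun v _ => KB_coc Γ G v _ _ _ (hK k v _))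
end Final

section Statements

variable {V : Type} [Fintype V] (Γ : SimpleGraph V) (G : V → Type) [∀ v, Group (G v)]

theorem stmt0 (h : ∀ v, WeaklyAmenableCH1 (G v)) :
    WeaklyAmenableCH1 (GraphProduct Γ G) := by
  exact main_gp Γ G h

end Statements
end

section
/- Let g, h ∈ G(Γ) with n = |g|_r and m = |h|_r. Then there exist integers q ≤ min(m,n) and p ≤ κ and reduced words g ≡ g₁⋯g_n and h ≡ h₁⋯h_m such that: g_i = h_i for 1 ≤ i ≤ q; for q < i ≤ q+p the syllables g_i and h_i lie in the same vertex group; the word h_m⁻¹⋯h_{q+p+1}⁻¹ (h_{q+1}⁻¹g_{q+1})⋯(h_{q+p}⁻¹g_{q+p}) g_{q+p+1}⋯g_n is a reduced word representing h⁻¹g; and for all 1 ≤ i, j ≤ p, the syllables h_{q+j} and g_{q+j} lie in G(st(v_{q+i})), where v_{q+i} is the vertex whose vertex group contains g_{q+i}. -/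
open scoped ComplexOrder commutatorElement

namespace GPAux

section Core

variable {V : Type} (Γ : SimpleGraph V) (G : V → Type) [∀ v, Group (G v)]

abbrev Syl := (v : V) × G v

inductive Sh : List (Syl G) → List (Syl G) → Prop
  | refl (w) : Sh w w
  | swap (s t : Syl G) (w) : Γ.Adj s.1 t.1 → Sh (s :: t :: w) (t :: s :: w)
  | cons (s : Syl G) {w w'} : Sh w w' → Sh (s :: w) (s :: w')
  | trans {a b c} : Sh a b → Sh b c → Sh a c

variable {Γ G}

theorem Sh.symm {a b : List (Syl G)} (h : Sh Γ G a b) : Sh Γ G b a := by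
  induction h with
  | refl w => exact Sh.refl w
  | swap s t w h => exact Sh.swap t s w h.symm
  | cons s _ ih => exact Sh.cons s ih
  | trans _ _ h1 h2 => exact h2.trans h1

theorem Sh.length {a b : List (Syl G)} (h : Sh Γ G a b) : a.length = b.length := by
  induction h with
  | refl w => rfl
  | swap s t w h => rfl
  | cons s _ ih => simp [ih]
  | trans _ _ h1 h2 => exact h1.trans h2

variable (Γ)

open Classical in
noncomputable def ext (v : V) : List (Syl G) → G v × List (Syl G)
  | [] => (1, [])
  | s :: w => if h : s.1 = v then (h ▸ s.2, w) else
      if Γ.Adj s.1 v then ((ext v w).1, s :: (ext v w).2) else (1, s :: w)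

def Fr (v : V) : List (Syl G) → Prop
  | [] => False
  | s :: w => s.1 = v ∨ (Γ.Adj s.1 v ∧ Fr v w)

def Red : List (Syl G) → Prop
  | [] => True
  | s :: w => s.2 ≠ 1 ∧ ¬ Fr Γ s.1 w ∧ Red w

open Classical in
noncomputable def pc (v : V) (x : G v) (k : List (Syl G)) : List (Syl G) :=
  if x = 1 then k else ⟨v, x⟩ :: k

noncomputable def act (v : V) (g : G v) (w : List (Syl G)) : List (Syl G) :=
  pc v (g * (ext Γ v w).1) (ext Γ v w).2

variable {Γ}

theorem ext_same (v : V) (x : G v) (w : List (Syl G)) : ext Γ v (⟨v, x⟩ :: w) = (x, w) := by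
  simp [ext]

theorem ext_adj {v : V} {s : Syl G} (w : List (Syl G)) (h : Γ.Adj s.1 v) :
    ext Γ v (s :: w) = ((ext Γ v w).1, s :: (ext Γ v w).2) := by
  simp [ext, h, h.ne]

theorem ext_not {v : V} {s : Syl G} (w : List (Syl G)) (h : ¬ Γ.Adj s.1 v) (h' : s.1 ≠ v) :
    ext Γ v (s :: w) = (1, s :: w) := by
  simp [ext, h, h']

theorem cases3 (Γ : SimpleGraph V) (v : V) (s : Syl G) :
    (∃ x, s = ⟨v, x⟩) ∨ Γ.Adj s.1 v ∨ (¬ Γ.Adj s.1 v ∧ s.1 ≠ v) := by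
  by_cases h : s.1 = v
  · left; obtain ⟨u, x⟩ := s; dsimp at h; subst h; exact ⟨x, rfl⟩
  · by_cases h2 : Γ.Adj s.1 v <;> simp [h, h2]

theorem ext_sh (v : V) {a b : List (Syl G)} (h : Sh Γ G a b) :
    (ext Γ v a).1 = (ext Γ v b).1 ∧ Sh Γ G (ext Γ v a).2 (ext Γ v b).2 := by
  induction h with
  | refl w => exact ⟨rfl, Sh.refl _⟩
  | cons s hw ih =>
    rcases cases3 Γ v s with ⟨x, rfl⟩ | h | ⟨h, h'⟩
    · rw [ext_same, ext_same]; exact ⟨rfl, hw⟩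
    · simp only [ext_adj _ h]; exact ⟨ih.1, Sh.cons _ ih.2⟩
    · rw [ext_not _ h h', ext_not _ h h']; exact ⟨rfl, Sh.cons _ hw⟩
  | trans _ _ h1 h2 => exact ⟨h1.1.trans h2.1, h1.2.trans h2.2⟩
  | swap s t w hst =>
    rcases cases3 Γ v s with ⟨x, rfl⟩ | h | ⟨h, h'⟩
    · have := hst.symm
      dsimp at this
      rw [ext_same, ext_adj _ this, ext_same]; exact ⟨rfl, Sh.refl _⟩
    · rcases cases3 Γ v t with ⟨y, rfl⟩ | k | ⟨k, k'⟩
      · rw [ext_same, ext_adj _ h, ext_same]; exact ⟨rfl, Sh.refl _⟩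
      · rw [ext_adj _ h, ext_adj _ k, ext_adj _ k, ext_adj _ h]
        exact ⟨rfl, Sh.swap _ _ _ hst⟩
      · rw [ext_adj _ h, ext_not _ k k', ext_not _ k k']
        exact ⟨rfl, Sh.swap _ _ _ hst⟩
    · rcases cases3 Γ v t with ⟨y, rfl⟩ | k | ⟨k, k'⟩
      · exact absurd hst h
      · rw [ext_adj _ k, ext_not _ h h', ext_not _ h h']
        exact ⟨rfl, Sh.swap _ _ _ hst⟩
      · rw [ext_not _ h h', ext_not _ k k']
        exact ⟨rfl, Sh.swap _ _ _ hst⟩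

theorem pc_sh (v : V) (x : G v) {a b : List (Syl G)} (h : Sh Γ G a b) :
    Sh Γ G (pc v x a) (pc v x b) := by
  unfold pc; split_ifs
  · exact h
  · exact Sh.cons _ h

theorem act_sh (v : V) (g : G v) {a b : List (Syl G)} (h : Sh Γ G a b) :
    Sh Γ G (act Γ v g a) (act Γ v g b) := by
  have := ext_sh v h
  unfold act; rw [this.1]; exact pc_sh v _ this.2

theorem ext_of_not_fr {v : V} {w : List (Syl G)} (h : ¬ Fr Γ v w) : ext Γ v w = (1, w) := by
  induction w with
  | nil => rfl
  | cons s w ih =>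
    rcases cases3 Γ v s with ⟨x, rfl⟩ | k | ⟨k, k'⟩
    · exact absurd (Or.inl rfl) h
    · rw [ext_adj _ k, ih (fun hh => h (Or.inr ⟨k, hh⟩))]
    · rw [ext_not _ k k']

theorem ext_pc_same (v : V) (x : G v) {k : List (Syl G)} (h : ¬ Fr Γ v k) :
    ext Γ v (pc v x k) = (x, k) := by
  unfold pc; split_ifs with hx
  · rw [ext_of_not_fr h, hx]
  · rw [ext_same]

theorem fr_ext_adj {u v : V} (h : Γ.Adj u v) (w : List (Syl G)) :
    Fr Γ u (ext Γ v w).2 ↔ Fr Γ u w := by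
  induction w with
  | nil => rfl
  | cons s w ih =>
    rcases cases3 Γ v s with ⟨x, rfl⟩ | k | ⟨k, k'⟩
    · rw [ext_same]; simp [Fr, h.symm, h.ne']
    · rw [ext_adj _ k]; simp [Fr, ih]
    · rw [ext_not _ k k']

theorem red_ext (v : V) {w : List (Syl G)} (h : Red Γ w) :
    Red Γ (ext Γ v w).2 ∧ ¬ Fr Γ v (ext Γ v w).2 := by
  induction w with
  | nil => simp [ext, Red, Fr]
  | cons s w ih =>
    obtain ⟨h1, h2, h3⟩ := h
    rcases cases3 Γ v s with ⟨x, rfl⟩ | k | ⟨k, k'⟩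
    · rw [ext_same]; exact ⟨h3, h2⟩
    · rw [ext_adj _ k]
      refine ⟨⟨h1, ?_, (ih h3).1⟩, ?_⟩
      · rwa [fr_ext_adj k]
      · rintro (e | e)
        · exact k.ne e
        · exact (ih h3).2 e.2
    · rw [ext_not _ k k']
      refine ⟨⟨h1, h2, h3⟩, ?_⟩
      rintro (e | e)
      · exact k' e
      · exact k e.1

theorem red_act (v : V) (g : G v) {w : List (Syl G)} (h : Red Γ w) : Red Γ (act Γ v g w) := by
  have := red_ext v h
  unfold act pc; split_ifs with hx
  · exact this.1
  · exact ⟨hx, this.2, this.1⟩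

theorem sh_ext (v : V) (w : List (Syl G)) : Sh Γ G (pc v (ext Γ v w).1 (ext Γ v w).2) w ∨
    ∃ s ∈ w, s.2 = 1 := by
  induction w with
  | nil => left; simp [ext, pc, Sh.refl]
  | cons s w ih =>
    rcases cases3 Γ v s with ⟨x, rfl⟩ | k | ⟨k, k'⟩
    · rw [ext_same]; unfold pc; split_ifs with hx
      · right; exact ⟨⟨v, x⟩, by simp, hx⟩
      · left; exact Sh.refl _
    · rw [ext_adj _ k]
      rcases ih with ih | ⟨t, ht, h⟩
      · left
        unfold pc at ih ⊢
        split_ifs at ih ⊢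
        · exact Sh.cons _ ih
        · exact (Sh.swap _ _ _ k.symm).trans (Sh.cons _ ih)
      · right; exact ⟨t, by simp [ht], h⟩
    · rw [ext_not _ k k']; left; simp [pc, Sh.refl]

theorem Red.ne_one {w : List (Syl G)} (h : Red Γ w) : ∀ s ∈ w, s.2 ≠ 1 := by
  induction w with
  | nil => simp
  | cons s w ih =>
    intro t ht
    rcases List.mem_cons.1 ht with rfl | ht
    · exact h.1
    · exact ih h.2.2 t ht

theorem act_one (v : V) {w : List (Syl G)} (h : Red Γ w) : Sh Γ G (act Γ v 1 w) w := by
  rcases sh_ext (Γ := Γ) v w with k | ⟨s, hs, h1⟩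
  · unfold act; rwa [one_mul]
  · exact absurd h1 (h.ne_one s hs)

theorem act_mul (v : V) (g h : G v) {w : List (Syl G)} (hw : Red Γ w) :
    act Γ v g (act Γ v h w) = act Γ v (g * h) w := by
  unfold act
  rw [ext_pc_same _ _ (red_ext v hw).2]
  simp [mul_assoc]

theorem ext_pc_adj {u v : V} (h : Γ.Adj u v) (x : G u) (k : List (Syl G)) :
    ext Γ v (pc u x k) = ((ext Γ v k).1, pc u x (ext Γ v k).2) := by
  unfold pc; split_ifs
  · rfl
  · rw [ext_adj _ (by exact h)]

theorem ext_ext {u v : V} (h : Γ.Adj u v) (w : List (Syl G)) :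
    (ext Γ v (ext Γ u w).2).1 = (ext Γ v w).1 ∧
    (ext Γ v (ext Γ u w).2).2 = (ext Γ u (ext Γ v w).2).2 := by
  induction w with
  | nil => simp [ext]
  | cons s w ih =>
    rcases cases3 Γ u s with ⟨x, rfl⟩ | k | ⟨k, k'⟩
    · rw [ext_same, ext_adj _ (by exact h), ext_same]; simp
    · rcases cases3 Γ v s with ⟨x, rfl⟩ | l | ⟨l, l'⟩
      · rw [ext_same, ext_adj _ k, ext_same]; simp
      · rw [ext_adj _ k, ext_adj _ l, ext_adj _ l, ext_adj _ k]; simp [ih]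
      · rw [ext_adj _ k, ext_not _ l l', ext_not _ l l', ext_adj _ k]; simp
    · rcases cases3 Γ v s with ⟨x, rfl⟩ | l | ⟨l, l'⟩
      · exact absurd h.symm k
      · rw [ext_not _ k k', ext_adj _ l, ext_not _ k k']; simp
      · rw [ext_not _ k k', ext_not _ l l', ext_not _ k k']; simp

theorem act_comm {u v : V} (h : Γ.Adj u v) (x : G u) (y : G v) (w : List (Syl G)) :
    Sh Γ G (act Γ v y (act Γ u x w)) (act Γ u x (act Γ v y w)) := by
  have e1 : act Γ v y (act Γ u x w) = pc v (y * (ext Γ v w).1)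
      (pc u (x * (ext Γ u w).1) (ext Γ v (ext Γ u w).2).2) := by
    unfold act; rw [ext_pc_adj h, (ext_ext h w).1]
  have e2 : act Γ u x (act Γ v y w) = pc u (x * (ext Γ u w).1)
      (pc v (y * (ext Γ v w).1) (ext Γ v (ext Γ u w).2).2) := by
    unfold act; rw [ext_pc_adj h.symm, (ext_ext h.symm w).1, (ext_ext h w).2]
  rw [e1, e2]
  unfold pc
  split_ifs
  · exact Sh.refl _
  · exact Sh.refl _
  · exact Sh.refl _
  · exact Sh.swap _ _ _ h.symm

theorem ext_len (v : V) (w : List (Syl G)) : (ext Γ v w).2.length ≤ w.length := by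
  induction w with
  | nil => simp [ext]
  | cons s w ih =>
    rcases cases3 Γ v s with ⟨x, rfl⟩ | k | ⟨k, k'⟩
    · rw [ext_same]; simp
    · rw [ext_adj _ k]; simpa using ih
    · rw [ext_not _ k k']

theorem act_len (v : V) (g : G v) (w : List (Syl G)) :
    (act Γ v g w).length ≤ w.length + 1 := by
  have := ext_len (Γ := Γ) v w
  unfold act pc; split_ifs
  · omega
  · simp; omega

theorem ext_fr {v : V} {w : List (Syl G)} (h : Fr Γ v w) :
    (ext Γ v w).2.length + 1 = w.length ∧ (∀ s ∈ (ext Γ v w).2, s ∈ w) ∧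
      (⟨v, (ext Γ v w).1⟩ : Syl G) ∈ w := by
  induction w with
  | nil => exact h.elim
  | cons s w ih =>
    rcases cases3 Γ v s with ⟨x, rfl⟩ | k | ⟨k, k'⟩
    · rw [ext_same]; simp +contextual
    · rw [ext_adj _ k]
      have : Fr Γ v w := by
        rcases h with h | h
        · exact absurd h k.ne
        · exact h.2
      obtain ⟨h1, h2, h3⟩ := ih this
      refine ⟨by simp [h1], ?_, by simp [h3]⟩
      intro t ht
      rcases List.mem_cons.1 ht with rfl | ht
      · simp
      · simp [h2 t ht]
    · rcases h with h | h
      · exact absurd h k'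
      · exact absurd h.1 k

variable (Γ G)

instance std : Setoid {w : List (Syl G) // Red Γ w} where
  r a b := Sh Γ G a.1 b.1
  iseqv := ⟨fun a => Sh.refl _, fun h => h.symm, fun h k => h.trans k⟩

abbrev Q := Quotient (std Γ G)

noncomputable def actQ (v : V) : G v →* Function.End (Q Γ G) where
  toFun g := Quotient.map (fun w => ⟨act Γ v g w.1, red_act v g w.2⟩) (fun _ _ h => act_sh v g h)
  map_one' := by
    funext x
    induction x using Quotient.inductionOn with
    | h w => exact Quotient.sound (act_one v w.2)
  map_mul' g h := by
    funext x
    induction x using Quotient.inductionOn with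
    | h w =>
      refine Quotient.sound ?_
      show Sh Γ G (act Γ v (g * h) w.1) (act Γ v g (act Γ v h w.1))
      rw [act_mul v g h w.2]; exact Sh.refl _

noncomputable def actC : Monoid.CoprodI G →* Function.End (Q Γ G) :=
  Monoid.CoprodI.lift (actQ Γ G)

theorem actC_ker : Subgroup.normalClosure (commRels Γ G) ≤ (actC Γ G).ker := by
  refine Subgroup.normalClosure_le_normal ?_
  rintro _ ⟨v, w, a, b, hvw, rfl⟩
  rw [SetLike.mem_coe, MonoidHom.mem_ker]
  have hc : actQ Γ G v a * actQ Γ G w b = actQ Γ G w b * actQ Γ G v a := by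
    funext x
    induction x using Quotient.inductionOn with
    | h k => exact Quotient.sound (act_comm hvw.symm b a k.1)
  have hc' : actC Γ G (Monoid.CoprodI.of a * Monoid.CoprodI.of b) =
      actC Γ G (Monoid.CoprodI.of b * Monoid.CoprodI.of a) := by
    simpa [actC] using hc
  have : (⁅Monoid.CoprodI.of a, Monoid.CoprodI.of b⁆ : Monoid.CoprodI G) =
     (Monoid.CoprodI.of a * Monoid.CoprodI.of b) *
      (Monoid.CoprodI.of b * Monoid.CoprodI.of a)⁻¹ := by
    rw [commutatorElement_def]; group
  rw [this, map_mul, hc', ← map_mul]; simp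

noncomputable def actG : GraphProduct Γ G →* Function.End (Q Γ G) :=
  QuotientGroup.lift _ (actC Γ G) (actC_ker Γ G)

theorem actG_syl (s : Syl G) : actG Γ G (ofSyl Γ G s) = actQ Γ G s.1 s.2 := by
  unfold actG ofSyl
  erw [QuotientGroup.lift_mk]

def base : Q Γ G := Quotient.mk _ ⟨[], trivial⟩

theorem wordProd_cons (s : Syl G) (w : List (Syl G)) :
    wordProd Γ G (s :: w) = ofSyl Γ G s * wordProd Γ G w := by simp [wordProd]

theorem wordProd_append (w w' : List (Syl G)) :
    wordProd Γ G (w ++ w') = wordProd Γ G w * wordProd Γ G w' := by simp [wordProd]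

theorem actG_word (w : List (Syl G)) : ∃ r : {w : List (Syl G) // Red Γ w},
    actG Γ G (wordProd Γ G w) (base Γ G) = Quotient.mk _ r ∧ r.1.length ≤ w.length := by
  induction w with
  | nil => exact ⟨⟨[], trivial⟩, by simp only [wordProd, List.map_nil, List.prod_nil, map_one]; rfl, by simp⟩
  | cons s w ih =>
    obtain ⟨r, h1, h2⟩ := ih
    refine ⟨⟨act Γ s.1 s.2 r.1, red_act _ _ r.2⟩, ?_, ?_⟩
    · rw [wordProd_cons, map_mul, actG_syl]
      show actQ Γ G s.1 s.2 (actG Γ G (wordProd Γ G w) (base Γ G)) = _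
      rw [h1]; rfl
    · have := act_len (Γ := Γ) s.1 s.2 r.1
      simp; omega

theorem actG_red (w : List (Syl G)) (hw : Red Γ w) :
    actG Γ G (wordProd Γ G w) (base Γ G) = Quotient.mk _ ⟨w, hw⟩ := by
  induction w with
  | nil => simp only [wordProd, List.map_nil, List.prod_nil, map_one]; rfl
  | cons s w ih =>
    rw [wordProd_cons, map_mul, actG_syl]
    show actQ Γ G s.1 s.2 (actG Γ G (wordProd Γ G w) (base Γ G)) = _
    rw [ih hw.2.2]
    have : act Γ s.1 s.2 w = s :: w := by
      unfold act; rw [ext_of_not_fr hw.2.1]; simp [pc, hw.1]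
    refine Quotient.sound ?_
    show Sh Γ G (act Γ s.1 s.2 w) (s :: w)
    rw [this]; exact Sh.refl _

variable {Γ G}

theorem Red.isReduced {w : List (Syl G)} (hw : Red Γ w) {g} (hg : wordProd Γ G w = g) :
    IsReducedWordOf Γ G w g := by
  refine ⟨⟨hw.ne_one, hg⟩, fun w' hw' => ?_⟩
  obtain ⟨r, h1, h2⟩ := actG_word Γ G w'
  rw [hw'.2, ← hg, actG_red Γ G w hw] at h1
  have : Sh Γ G w r.1 := Quotient.exact h1
  rw [this.length]; exact h2

theorem ofSyl_mul (v : V) (x y : G v) :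
    ofSyl Γ G ⟨v, x * y⟩ = ofSyl Γ G ⟨v, x⟩ * ofSyl Γ G ⟨v, y⟩ := by
  simp [ofSyl]

theorem ofSyl_one (v : V) : ofSyl Γ G ⟨v, 1⟩ = 1 := by
  simp [ofSyl]

theorem ofSyl_inv (v : V) (x : G v) : ofSyl Γ G ⟨v, x⁻¹⟩ = (ofSyl Γ G ⟨v, x⟩)⁻¹ := by
  simp [ofSyl]

theorem ofSyl_comm {s t : Syl G} (h : Γ.Adj s.1 t.1) :
    Commute (ofSyl Γ G s) (ofSyl Γ G t) := by
  have : (⁅ofSyl Γ G s, ofSyl Γ G t⁆ : GraphProduct Γ G) = 1 := by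
    have h1 : (⁅Monoid.CoprodI.of s.2, Monoid.CoprodI.of t.2⁆ : Monoid.CoprodI G) ∈
      Subgroup.normalClosure (commRels Γ G) :=
      Subgroup.subset_normalClosure ⟨_, _, _, _, h, rfl⟩
    exact (QuotientGroup.eq_one_iff _).2 h1
  exact commutatorElement_eq_one_iff_commute.1 this

theorem wordProd_comm {s : Syl G} {w : List (Syl G)} (h : ∀ t ∈ w, Γ.Adj s.1 t.1) :
    Commute (ofSyl Γ G s) (wordProd Γ G w) := by
  induction w with
  | nil => simp [wordProd]
  | cons t w ih =>
    rw [wordProd_cons]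
    exact (ofSyl_comm (h t (by simp))).mul_right (ih fun r hr => h r (by simp [hr]))

theorem wordProd_ext (v : V) (w : List (Syl G)) :
    ofSyl Γ G ⟨v, (ext Γ v w).1⟩ * wordProd Γ G (ext Γ v w).2 = wordProd Γ G w := by
  induction w with
  | nil => simp [ext, ofSyl_one]
  | cons s w ih =>
    rcases cases3 Γ v s with ⟨x, rfl⟩ | k | ⟨k, k'⟩
    · rw [ext_same, wordProd_cons]
    · rw [ext_adj _ k]
      simp only [wordProd_cons]
      rw [← ih, ← mul_assoc, ← mul_assoc,
        (ofSyl_comm (s := s) (t := ⟨v, (ext Γ v w).1⟩) k).eq]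
    · rw [ext_not _ k k']; simp [ofSyl_one]

theorem red_of_min (w : List (Syl G)) (h : IsReducedWordOf Γ G w (wordProd Γ G w)) :
    Red Γ w := by
  induction w with
  | nil => trivial
  | cons s w ih =>
    obtain ⟨⟨h1, -⟩, h2⟩ := h
    have hne : ∀ t ∈ w, t.2 ≠ 1 := fun t ht => h1 t (by simp [ht])
    refine ⟨h1 s (by simp), ?_, ih ⟨⟨hne, rfl⟩, ?_⟩⟩
    · intro hf
      obtain ⟨e1, e2, e3⟩ := ext_fr hf
      have key : wordProd Γ G (s :: w) =
          ofSyl Γ G ⟨s.1, s.2 * (ext Γ s.1 w).1⟩ * wordProd Γ G (ext Γ s.1 w).2 := by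
        rw [wordProd_cons, ← wordProd_ext s.1 w, ofSyl_mul, mul_assoc]
      by_cases hx : s.2 * (ext Γ s.1 w).1 = 1
      · have := h2 (ext Γ s.1 w).2 ⟨fun t ht => hne t (e2 t ht), by
          rw [key, hx, ofSyl_one, one_mul]⟩
        simp at this; omega
      · have := h2 (⟨s.1, s.2 * (ext Γ s.1 w).1⟩ :: (ext Γ s.1 w).2) ⟨by
          intro t ht
          rcases List.mem_cons.1 ht with rfl | ht
          · exact hx
          · exact hne t (e2 t ht), by rw [key, wordProd_cons]⟩
        simp at this; omega
    · intro w' hw'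
      have := h2 (s :: w') ⟨by
        intro t ht
        rcases List.mem_cons.1 ht with rfl | ht
        · exact h1 _ (by simp)
        · exact hw'.1 t ht, by rw [wordProd_cons, hw'.2, wordProd_cons]⟩
      simpa using this

theorem red_iff {w : List (Syl G)} {g} :
    IsReducedWordOf Γ G w g ↔ Red Γ w ∧ wordProd Γ G w = g := by
  constructor
  · intro h
    have := h.1.2
    subst this
    exact ⟨red_of_min w h, rfl⟩
  · rintro ⟨h, h'⟩; exact h.isReduced h'

theorem exists_word (g : GraphProduct Γ G) : ∃ w, IsWordOf Γ G w g := by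
  classical
  obtain ⟨x, rfl⟩ := QuotientGroup.mk_surjective g
  induction x using Monoid.CoprodI.induction_on with
  | one => exact ⟨[], by simp, by simp [wordProd]⟩
  | of v x =>
    by_cases hx : x = 1
    · subst hx; exact ⟨[], by simp, by simp [wordProd]⟩
    · exact ⟨[⟨v, x⟩], by simpa using hx, by simp [wordProd, ofSyl]⟩
  | mul x y hx hy =>
    obtain ⟨a, ha, ha'⟩ := hx
    obtain ⟨b, hb, hb'⟩ := hy
    refine ⟨a ++ b, ?_, by rw [wordProd_append, ha', hb']; simp⟩
    intro s hs
    rcases List.mem_append.1 hs with h | h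
    · exact ha s h
    · exact hb s h

theorem exists_red (g : GraphProduct Γ G) : ∃ w, IsReducedWordOf Γ G w g := by
  classical
  have hex : ∃ n, ∃ w, IsWordOf Γ G w g ∧ w.length = n := by
    obtain ⟨w, hw⟩ := exists_word g
    exact ⟨_, w, hw, rfl⟩
  obtain ⟨w, hw, hl⟩ := Nat.find_spec hex
  exact ⟨w, hw, fun w' hw' => hl ▸ Nat.find_min' hex ⟨w', hw', rfl⟩⟩

theorem fr_append (v : V) (l r : List (Syl G)) :
    Fr Γ v (l ++ r) ↔ Fr Γ v l ∨ ((∀ z ∈ l, Γ.Adj z.1 v) ∧ Fr Γ v r) := by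
  induction l with
  | nil => simp [Fr]
  | cons s l ih => simp [Fr, ih]; tauto

theorem red_append (l r : List (Syl G)) :
    Red Γ (l ++ r) ↔ Red Γ l ∧ Red Γ r ∧ ∀ v, Fr Γ v l.reverse → ¬ Fr Γ v r := by
  induction l with
  | nil => simp [Red, Fr]
  | cons s l ih =>
    simp only [List.cons_append, Red, ih, fr_append, List.reverse_cons, Fr, List.mem_reverse]
    constructor
    · rintro ⟨h1, h2, h3, h4, h5⟩
      refine ⟨⟨h1, fun h => h2 (Or.inl h), h3⟩, h4, ?_⟩
      rintro v (h | ⟨h, rfl | h⟩) hr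
      · exact h5 v h hr
      · exact h2 (Or.inr ⟨h, hr⟩)
      · exact h.2
    · rintro ⟨⟨h1, h2, h3⟩, h4, h5⟩
      refine ⟨h1, ?_, h3, h4, fun v h => h5 v (Or.inl h)⟩
      rintro (h | h)
      · exact h2 h
      · exact h5 _ (Or.inr ⟨h.1, Or.inl rfl⟩) h.2

theorem red_reverse (w : List (Syl G)) : Red Γ w.reverse ↔ Red Γ w := by
  induction w with
  | nil => simp
  | cons s w ih =>
    rw [List.reverse_cons, red_append, List.reverse_reverse, ih]
    simp only [Red, Fr]
    constructor
    · rintro ⟨h1, h2, h3⟩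
      exact ⟨h2.1, fun h => h3 _ h (Or.inl rfl), h1⟩
    · rintro ⟨h1, h2, h3⟩
      refine ⟨h3, ⟨h1, by simp, trivial⟩, ?_⟩
      rintro v hv (rfl | h)
      · exact h2 hv
      · exact h.2

def sinv (s : Syl G) : Syl G := ⟨s.1, s.2⁻¹⟩

theorem fr_inv (v : V) (w : List (Syl G)) : Fr Γ v (w.map sinv) ↔ Fr Γ v w := by
  induction w with
  | nil => simp
  | cons s w ih => simp only [List.map_cons, Fr, ih]; rfl

theorem red_inv (w : List (Syl G)) : Red Γ (w.map sinv) ↔ Red Γ w := by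
  induction w with
  | nil => simp
  | cons s w ih => simp [Red, fr_inv, ih, sinv]

theorem wordProd_inv (w : List (Syl G)) :
    wordProd Γ G (w.reverse.map sinv) = (wordProd Γ G w)⁻¹ := by
  induction w with
  | nil => simp [wordProd]
  | cons s w ih =>
    rw [List.reverse_cons, List.map_append, wordProd_append, ih, wordProd_cons, mul_inv_rev]
    simp [wordProd, sinv, ofSyl_inv]

theorem fr_clique {v : V} {w : List (Syl G)} (h : w.Pairwise (fun s t => Γ.Adj s.1 t.1))
    : Fr Γ v w ↔ ∃ s ∈ w, s.1 = v := by
  induction w with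
  | nil => simp [Fr]
  | cons s w ih =>
    rw [List.pairwise_cons] at h
    simp only [Fr, ih h.2, List.mem_cons, exists_eq_or_imp]
    constructor
    · tauto
    · rintro (h1 | ⟨t, ht, rfl⟩)
      · exact Or.inl h1
      · exact Or.inr ⟨h.1 t ht, t, ht, rfl⟩

theorem red_clique {w : List (Syl G)} (h : w.Pairwise (fun s t => Γ.Adj s.1 t.1))
    (h1 : ∀ s ∈ w, s.2 ≠ 1) : Red Γ w := by
  induction w with
  | nil => trivial
  | cons s w ih =>
    rw [List.pairwise_cons] at h
    refine ⟨h1 s (by simp), ?_, ih h.2 fun t ht => h1 t (by simp [ht])⟩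
    rw [fr_clique h.2]
    rintro ⟨t, ht, e⟩
    exact (h.1 t ht).ne e.symm

/-- replace the tail of a reduced word -/
theorem swap_tail {x b b' : List (Syl G)} {g} (h : IsReducedWordOf Γ G (x ++ b) g)
    (hp : wordProd Γ G b' = wordProd Γ G b) (hl : b'.length = b.length)
    (hn : ∀ s ∈ b', s ∈ b) : IsReducedWordOf Γ G (x ++ b') g := by
  refine ⟨⟨?_, ?_⟩, fun w' hw' => ?_⟩
  · intro s hs
    rcases List.mem_append.1 hs with k | k
    · exact h.1.1 s (by simp [k])
    · exact h.1.1 s (by simp [hn s k])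
  · rw [← h.1.2, wordProd_append, wordProd_append, hp]
  · have := h.2 w' hw'
    simp at this ⊢; omega

/-- pairs of syllables in one vertex group -/
abbrev Pr (G : V → Type) := (v : V) × (G v × G v)

def f1 (x : Pr G) : Syl G := ⟨x.1, x.2.1⟩
def f2 (x : Pr G) : Syl G := ⟨x.1, x.2.2⟩
def f3 (x : Pr G) : Syl G := ⟨x.1, x.2.2⁻¹ * x.2.1⟩

theorem wordProd_f3 {L : List (Pr G)} (h : L.Pairwise (fun s t => Γ.Adj s.1 t.1)) :
    wordProd Γ G (L.map f3) = (wordProd Γ G (L.map f2))⁻¹ * wordProd Γ G (L.map f1) := by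
  induction L with
  | nil => simp [wordProd]
  | cons x L ih =>
    rw [List.pairwise_cons] at h
    simp only [List.map_cons, wordProd_cons, ih h.2]
    have hc : Commute (ofSyl Γ G (f3 x)) (wordProd Γ G (L.map f2)) := by
      apply wordProd_comm
      intro t ht
      obtain ⟨y, hy, rfl⟩ := List.mem_map.1 ht
      exact h.1 y hy
    rw [← mul_assoc, hc.inv_right.eq, mul_inv_rev]
    have : ofSyl Γ G (f3 x) = (ofSyl Γ G (f2 x))⁻¹ * ofSyl Γ G (f1 x) := by
      simp only [f3, f2, f1, ofSyl_mul, ofSyl_inv]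
    rw [this]; group

def PP (g h : GraphProduct Γ G) (q p : ℕ) : Prop :=
  ∃ (x a b : List (Syl G)) (L : List (Pr G)), x.length = q ∧ L.length = p ∧
    L.Pairwise (fun s t => Γ.Adj s.1 t.1) ∧
    IsReducedWordOf Γ G (x ++ (L.map f1 ++ a)) g ∧ IsReducedWordOf Γ G (x ++ (L.map f2 ++ b)) h

theorem exists_max (P : ℕ → Prop) (n : ℕ) (h0 : ∃ k, P k) (hb : ∀ k, P k → k ≤ n) :
    ∃ k, P k ∧ ∀ k', P k' → k' ≤ k := by
  classical
  obtain ⟨k, hk⟩ := h0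
  exact ⟨Nat.findGreatest P n, Nat.findGreatest_spec (hb k hk) hk,
    fun k' hk' => Nat.le_findGreatest (hb k' hk') hk'⟩

theorem move_front {x a : List (Syl G)} {L1 L2 : List (Syl G)} {s : Syl G} {g}
    (h : IsReducedWordOf Γ G (x ++ ((L1 ++ s :: L2) ++ a)) g) (hs : ∀ t ∈ L1, Γ.Adj t.1 s.1) :
    IsReducedWordOf Γ G ((x ++ [s]) ++ (L1 ++ L2 ++ a)) g := by
  rw [List.append_assoc]
  refine swap_tail h ?_ ?_ ?_
  · have := (wordProd_comm (s := s) (w := L1) fun t ht => (hs t ht).symm).eq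
    simp only [List.singleton_append, wordProd_cons, wordProd_append, ← mul_assoc, this]
  · simp; omega
  · intro t ht; simp at ht ⊢; tauto

theorem move_v {x L a : List (Syl G)} {v : V} {g}
    (h : IsReducedWordOf Γ G (x ++ (L ++ a)) g) (hf : Fr Γ v a) :
    IsReducedWordOf Γ G (x ++ ((L ++ [⟨v, (ext Γ v a).1⟩]) ++ (ext Γ v a).2)) g := by
  obtain ⟨e1, e2, e3⟩ := ext_fr hf
  refine swap_tail h ?_ ?_ ?_
  · rw [List.append_assoc]
    simp only [List.singleton_append, wordProd_cons, wordProd_append, wordProd_ext]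
  · simp; omega
  · intro t ht
    simp at ht ⊢
    rcases ht with h | rfl | h
    · exact Or.inl h
    · exact Or.inr e3
    · exact Or.inr (e2 t h)

end Core

theorem main {V : Type} [Fintype V] (Γ : SimpleGraph V) (G : V → Type) [∀ v, Group (G v)]
    (g h : GraphProduct Γ G) :
    ∃ (x a b : List (Syl G)) (L : List (Pr G)),
    L.length ≤ kappa Γ ∧
    L.Pairwise (fun s t => Γ.Adj s.1 t.1) ∧
    IsReducedWordOf Γ G (x ++ (L.map f1 ++ a)) g ∧
    IsReducedWordOf Γ G (x ++ (L.map f2 ++ b)) h ∧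
    IsReducedWordOf Γ G (b.reverse.map sinv ++ L.map f3 ++ a) (h⁻¹ * g) := by
  obtain ⟨wg, hg⟩ := exists_red g
  obtain ⟨wh, hh⟩ := exists_red h
  have bound : ∀ q p, PP g h q p → q + p ≤ wg.length := by
    rintro q p ⟨x, a, b, L, rfl, rfl, -, h1, -⟩
    have := h1.2 _ hg.1
    simp at this; omega
  obtain ⟨q, hq, hqm⟩ := exists_max (fun q => PP g h q 0) wg.length
    ⟨0, [], wg, wh, [], by simp, by simp, by simp, by simpa using hg, by simpa using hh⟩
    (fun k hk => by have := bound _ _ hk; omega)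
  obtain ⟨p, hp, hpm⟩ := exists_max (fun p => PP g h q p) wg.length ⟨0, hq⟩
    (fun k hk => by have := bound _ _ hk; omega)
  obtain ⟨x, a, b, L, hx, hL, hpw, h1, h2⟩ := hp
  have hpw1 : (L.map f1).Pairwise (fun s t : Syl G => Γ.Adj s.1 t.1) := by
    rw [List.pairwise_map]; exact hpw
  have hpw2 : (L.map f2).Pairwise (fun s t : Syl G => Γ.Adj s.1 t.1) := by
    rw [List.pairwise_map]; exact hpw
  have hpw3 : (L.map f3).Pairwise (fun s t : Syl G => Γ.Adj s.1 t.1) := by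
    rw [List.pairwise_map]; exact hpw
  have hne : ∀ y ∈ L, y.2.1 ≠ y.2.2 := by
    intro y hy e
    obtain ⟨L1, L2, rfl⟩ := List.append_of_mem hy
    have hadj : ∀ z ∈ L1, Γ.Adj z.1 y.1 := by
      intro z hz
      exact (List.pairwise_append.1 hpw).2.2 z hz y (by simp)
    rw [List.map_append, List.map_cons] at h1 h2
    have k1 := move_front h1 (by
      intro t ht; obtain ⟨z, hz, rfl⟩ := List.mem_map.1 ht; exact hadj z hz)
    have k2 := move_front h2 (by
      intro t ht; obtain ⟨z, hz, rfl⟩ := List.mem_map.1 ht; exact hadj z hz)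
    have e' : f2 y = f1 y := by simp [f1, f2, e]
    rw [e'] at k2
    have := hqm (q + 1) ⟨x ++ [f1 y], _, _, [], by simp [hx], rfl, by simp,
      by simpa using k1, by simpa using k2⟩
    omega
  refine ⟨x, a, b, L, ?_, hpw, h1, h2, ?_⟩
  · classical
    have hnd : (L.map (·.1)).Nodup := by
      rw [List.Nodup, List.pairwise_map]
      exact hpw.imp fun h => h.ne
    refine le_csSup ⟨Fintype.card V, ?_⟩ ⟨(L.map (·.1)).toFinset, ?_⟩
    · rintro n ⟨s, hs⟩
      rw [← hs.card_eq]; exact Finset.card_le_univ s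
    · refine ⟨?_, by rw [List.toFinset_card_of_nodup hnd]; simp⟩
      intro u hu w hw huw
      simp only [List.coe_toFinset, Set.mem_ofPred_eq] at hu hw
      have : (L.map (·.1)).Pairwise Γ.Adj := by rw [List.pairwise_map]; exact hpw
      obtain ⟨i, li, rfl⟩ := List.mem_iff_getElem.1 hu
      obtain ⟨j, lj, rfl⟩ := List.mem_iff_getElem.1 hw
      rw [List.pairwise_iff_getElem] at this
      rcases lt_trichotomy i j with k | k | k
      · exact this _ _ _ _ k
      · subst k; exact absurd rfl huw
      · exact (this _ _ _ _ k).symm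
  · obtain ⟨r1, p1⟩ := red_iff.1 h1
    obtain ⟨r2, p2⟩ := red_iff.1 h2
    refine red_iff.2 ⟨?_, ?_⟩
    · obtain ⟨-, r1, -⟩ := (red_append _ _).1 r1
      obtain ⟨-, r2, -⟩ := (red_append _ _).1 r2
      obtain ⟨-, ra, ca⟩ := (red_append _ _).1 r1
      obtain ⟨-, rb, cb⟩ := (red_append _ _).1 r2
      have bk : ∀ (f : Pr G → Syl G), (∀ y, (f y).1 = y.1) → ∀ v,
          Fr Γ v (L.map f).reverse ↔ ∃ y ∈ L, y.1 = v := by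
        intro f hf v
        rw [fr_clique]
        · constructor
          · rintro ⟨s, hs, rfl⟩
            rw [List.mem_reverse] at hs
            obtain ⟨y, hy, rfl⟩ := List.mem_map.1 hs
            exact ⟨y, hy, (hf y).symm⟩
          · rintro ⟨y, hy, rfl⟩
            exact ⟨f y, List.mem_reverse.2 (List.mem_map_of_mem hy), hf y⟩
        · rw [List.pairwise_reverse, List.pairwise_map]
          exact hpw.imp fun {s t} h => by rw [hf, hf]; exact h.symm
      rw [List.append_assoc, red_append, red_append]
      refine ⟨?_, ⟨?_, ra, ?_⟩, ?_⟩
      · rw [red_inv, red_reverse]; exact rb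
      · apply red_clique hpw3
        intro s hs
        obtain ⟨y, hy, rfl⟩ := List.mem_map.1 hs
        intro e
        exact hne y hy (inv_mul_eq_one.1 e).symm
      · intro v hv
        rw [bk f3 (fun _ => rfl)] at hv
        exact ca v ((bk f1 (fun _ => rfl) v).2 hv)
      · intro v hv
        rw [← List.map_reverse, List.reverse_reverse, fr_inv] at hv
        rw [fr_append]
        rintro (k | ⟨k, ka⟩)
        · rw [fr_clique hpw3] at k
          obtain ⟨s, hs, rfl⟩ := k
          obtain ⟨y, hy, rfl⟩ := List.mem_map.1 hs
          exact cb _ ((bk f2 (fun _ => rfl) _).2 ⟨y, hy, rfl⟩) hv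
        · have k1 := move_v h1 ka
          have k2 := move_v h2 hv
          have := hpm (p + 1) ⟨x, _, _, L ++ [⟨v, ((ext Γ v a).1, (ext Γ v b).1)⟩], hx,
            by simp [hL], ?_, by rw [List.map_append]; exact k1,
            by rw [List.map_append]; exact k2⟩
          · omega
          · rw [List.pairwise_append]
            refine ⟨hpw, by simp, ?_⟩
            intro y hy z hz
            rw [List.mem_singleton] at hz
            subst hz
            exact k (f3 y) (List.mem_map_of_mem hy)
    · rw [← p1, ← p2]
      simp only [wordProd_append, wordProd_inv, wordProd_f3 hpw]
      group

end GPAux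

section Statements

variable {V : Type} [Fintype V] (Γ : SimpleGraph V) (G : V → Type) [∀ v, Group (G v)]

theorem stmt2 (g h : GraphProduct Γ G) :
    ∃ (q p : ℕ) (wg wh : List ((v : V) × G v)),
      IsReducedWordOf Γ G wg g ∧ IsReducedWordOf Γ G wh h ∧
      q ≤ min wh.length wg.length ∧ p ≤ kappa Γ ∧
      q + p ≤ min wh.length wg.length ∧
      (∀ i < q, wg[i]? = wh[i]?) ∧
      (∃ t2 : List ((v : V) × G v), t2.length = p ∧
        IsReducedWordOf Γ G
          (((wh.drop (q + p)).reverse.map (fun s => ⟨s.1, s.2⁻¹⟩)) ++ t2 ++ wg.drop (q + p))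
          (h⁻¹ * g) ∧
        ∀ j < p, ∀ st sg sh : (v : V) × G v,
          t2[j]? = some st → wg[q + j]? = some sg → wh[q + j]? = some sh →
          ∃ hv : sh.1 = sg.1,
            st = ⟨sg.1, (cast (congrArg G hv) sh.2)⁻¹ * sg.2⟩) ∧
      (∀ i j, q ≤ i → i < q + p → q ≤ j → j < q + p →
        ∀ si sg sh : (v : V) × G v,
          wg[i]? = some si → wg[j]? = some sg → wh[j]? = some sh →
          (sg.1 = si.1 ∨ Γ.Adj sg.1 si.1) ∧ (sh.1 = si.1 ∨ Γ.Adj sh.1 si.1)) := by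
  obtain ⟨x, a, b, L, hk, hpw, h1, h2, h3⟩ := GPAux.main Γ G g h
  have hm : ∀ (f : GPAux.Pr G → (v : V) × G v) (c : List ((v : V) × G v)) (i : ℕ)
      (s : (v : V) × G v), i < L.length →
      (x ++ (L.map f ++ c))[x.length + i]? = some s → ∃ y, L[i]? = some y ∧ s = f y := by
    intro f c i s hi e
    rw [List.getElem?_append_right (by omega), Nat.add_sub_cancel_left,
      List.getElem?_append_left (by simpa using hi), List.getElem?_map] at e
    obtain ⟨y, hy, e⟩ := Option.map_eq_some_iff.1 e
    exact ⟨y, hy, e.symm⟩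
  have hd : ∀ (f : GPAux.Pr G → (v : V) × G v) (c : List ((v : V) × G v)),
      (x ++ (L.map f ++ c)).drop (x.length + L.length) = c := by
    intro f c
    rw [← List.append_assoc]
    exact List.drop_left' (by simp)
  refine ⟨x.length, L.length, _, _, h1, h2, by simp, hk, ?_, ?_, ⟨L.map GPAux.f3, by simp, ?_, ?_⟩, ?_⟩
  · simp only [List.length_append, List.length_map]; omega
  · intro i hi
    rw [List.getElem?_append_left hi, List.getElem?_append_left hi]
  · rw [hd, hd]; exact h3
  · intro j hj st sg sh e1 e2 e3
    obtain ⟨y, hy, rfl⟩ := hm _ _ _ _ hj e2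
    obtain ⟨z, hz, rfl⟩ := hm _ _ _ _ hj e3
    rw [List.getElem?_map, hy] at e1
    rw [hy] at hz
    obtain rfl := Option.some.inj hz
    obtain rfl := Option.some.inj e1
    exact ⟨rfl, rfl⟩
  · intro i j hi hi' hj hj' si sg sh e1 e2 e3
    obtain ⟨i, rfl⟩ := Nat.exists_eq_add_of_le hi
    obtain ⟨j, rfl⟩ := Nat.exists_eq_add_of_le hj
    obtain ⟨u, hu, rfl⟩ := hm _ _ _ _ (by omega) e1
    obtain ⟨y, hy, rfl⟩ := hm _ _ _ _ (by omega) e2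
    obtain ⟨z, hz, rfl⟩ := hm _ _ _ _ (by omega) e3
    rw [hy] at hz
    obtain rfl := Option.some.inj hz
    have key : y.1 = u.1 ∨ Γ.Adj y.1 u.1 := by
      obtain ⟨li, rfl⟩ := List.getElem?_eq_some_iff.1 hu
      obtain ⟨lj, rfl⟩ := List.getElem?_eq_some_iff.1 hy
      rw [List.pairwise_iff_getElem] at hpw
      rcases lt_trichotomy i j with k | k | k
      · exact Or.inr (hpw _ _ _ _ k).symm
      · subst k; exact Or.inl rfl
      · exact Or.inr (hpw _ _ _ _ k)
    exact ⟨key, key⟩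

end Statements
end
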